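/- arXiv:2305.16119 — 5 statements merged into one kernel-verified Lean document; each statement's English description precedes it below -/
import Mathlib

section
/- Suppose q ≡ 2 (mod 3), and let w = (0, 0, 0 | x_1, 0, 0) ∈ U. The number of white points ⟨v⟩ of U such that B_Q(w, v) = 0 equals q^{11} + (q^4 + 1)(q^{11} − 1)/(q − 1). -/
/-!  The split octonion algebra `O` over a finite field `F` of order `q`,
represented as `Fin 8 → F` with coordinates with respect to the basis
`x_1, …, x_8` (index `i : Fin 8` corresponds to `x_{i+1}`). -/

variable {F : Type*}

/-- The split octonion multiplication, determined by the table
`x_1x_5 = x_1`, `x_1x_6 = x_2`, `x_1x_7 = −x_3`, `x_1x_8 = −x_4`, `x_2x_3 = −x_1`,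
`x_2x_4 = x_2`, `x_2x_7 = −x_5`, `x_2x_8 = x_6`, `x_3x_2 = x_1`, `x_3x_4 = x_3`,
`x_3x_6 = −x_5`, `x_3x_8 = −x_7` (the sign of `x_3x_8` is forced by `x_8x_3 = x_7` and anti-commutativity of orthogonal imaginary octonions; with it `O` is the split octonion composition algebra), `x_4x_1 = x_1`, `x_4x_4 = x_4`, `x_4x_6 = x_6`,
`x_4x_7 = x_7`, `x_5x_2 = x_2`, `x_5x_3 = x_3`, `x_5x_5 = x_5`, `x_5x_8 = x_8`,
`x_6x_1 = −x_2`, `x_6x_3 = −x_4`, `x_6x_5 = x_6`, `x_6x_7 = x_8`, `x_7x_1 = x_3`,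
`x_7x_2 = −x_4`, `x_7x_5 = x_7`, `x_7x_6 = −x_8`, `x_8x_1 = −x_5`, `x_8x_2 = −x_6`,
`x_8x_3 = x_7`, `x_8x_4 = x_8`, all other products of basis elements being `0`. -/
def octMul [Field F] (a b : Fin 8 → F) : Fin 8 → F :=
  ![a 0 * b 4 - a 1 * b 2 + a 2 * b 1 + a 3 * b 0,
    a 0 * b 5 + a 1 * b 3 + a 4 * b 1 - a 5 * b 0,
    -(a 0 * b 6) + a 2 * b 3 + a 4 * b 2 + a 6 * b 0,
    -(a 0 * b 7) + a 3 * b 3 - a 5 * b 2 - a 6 * b 1,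
    -(a 1 * b 6) - a 2 * b 5 + a 4 * b 4 - a 7 * b 0,
    a 1 * b 7 + a 3 * b 5 + a 5 * b 4 - a 7 * b 1,
    -(a 2 * b 7) + a 3 * b 6 + a 6 * b 4 + a 7 * b 2,
    a 4 * b 7 + a 5 * b 6 - a 6 * b 5 + a 7 * b 3]

/-- The identity `1 = x_4 + x_5` of the octonion algebra. -/
def octOne [Field F] : Fin 8 → F := ![0, 0, 0, 1, 1, 0, 0, 0]

/-- Octonion conjugation: swaps `x_4, x_5` and negates the other basis vectors. -/
def octConj [Field F] (a : Fin 8 → F) : Fin 8 → F :=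
  ![-a 0, -a 1, -a 2, a 4, a 3, -a 5, -a 6, -a 7]

/-- The trace `Tr(Σ λ_i x_i) = λ_4 + λ_5`. -/
def octTr [Field F] (a : Fin 8 → F) : F := a 3 + a 4

/-- The norm `N(Σ λ_i x_i) = λ_1λ_8 + λ_2λ_7 + λ_3λ_6 + λ_4λ_5`. -/
def octN [Field F] (a : Fin 8 → F) : F :=
  a 0 * a 7 + a 1 * a 6 + a 2 * a 5 + a 3 * a 4

/-- The bilinear form `B(x,y) = N(x+y) − N(x) − N(y)`. -/
def octB [Field F] (a b : Fin 8 → F) : F := octN (a + b) - octN a - octN b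

/-- The basis octonion `x_1`. -/
def octX1 [Field F] : Fin 8 → F := ![1, 0, 0, 0, 0, 0, 0, 0]

/-- The 27-dimensional space `A = F × F × F × O × O × O`, whose elements encode the
Hermitian matrices `(λ, λ', λ'' | D, E, F)`. -/
abbrev Alb (F : Type*) := F × F × F × (Fin 8 → F) × (Fin 8 → F) × (Fin 8 → F)

/-- `v ∈ U`, i.e. `v` has trace `λ + λ' + λ'' = 0`. -/
def albInU [Field F] (v : Alb F) : Prop := v.1 + v.2.1 + v.2.2.1 = 0

/-- The quadratic form `Q((λ, λ', λ'' | D, E, F)) = λ² + λλ' + λ'² + N(D) + N(E) + N(F)`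
(on `U`). -/
def albQ [Field F] (v : Alb F) : F :=
  v.1 ^ 2 + v.1 * v.2.1 + v.2.1 ^ 2 +
    octN v.2.2.2.1 + octN v.2.2.2.2.1 + octN v.2.2.2.2.2

/-- The polar form `B_Q(u, v) = Q(u + v) − Q(u) − Q(v)`. -/
def albB [Field F] (u v : Alb F) : F := albQ (u + v) - albQ u - albQ v

/-- A vector of `U` is *white* if it has one of the forms (I), (II), (III). -/
def IsWhite [Field F] (v : Alb F) : Prop :=
  (∃ f : F, f ≠ 0 ∧ ∃ A B : Fin 8 → F, octN A + octN B + 1 = 0 ∧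
    v = (f * octN A, f * octN B, f, f • octConj B, f • A, f • octMul (octConj A) B)) ∨
  (∃ e : F, e ≠ 0 ∧ ∃ A C : Fin 8 → F, octN A = 0 ∧ octN C + 1 = 0 ∧
    v = (e * octN C, e, 0, e • A, e • octConj (octMul C A), e • C)) ∨
  (∃ D E G : Fin 8 → F, ¬(D = 0 ∧ E = 0 ∧ G = 0) ∧
    octN D = 0 ∧ octN E = 0 ∧ octN G = 0 ∧
    octMul D E = 0 ∧ octMul E G = 0 ∧ octMul G D = 0 ∧
    v = (0, 0, 0, D, E, G))

/-- The set of white points: the `1`-dimensional subspaces spanned by white vectors. -/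
def whitePoints (F : Type*) [Field F] : Set (Submodule F (Alb F)) :=
  {P | ∃ v : Alb F, IsWhite v ∧ P = Submodule.span F {v}}

section Octonions

variable [Field F]

lemma octB_eq (a b : Fin 8 → F) :
    octB a b = a 0 * b 7 + a 7 * b 0 + a 1 * b 6 + a 6 * b 1 + a 2 * b 5 + a 5 * b 2 +
      a 3 * b 4 + a 4 * b 3 := by
  simp only [octB, octN, Pi.add_apply]
  ring

lemma octConj_octConj (a : Fin 8 → F) : octConj (octConj a) = a := by
  funext i
  fin_cases i <;> simp [octConj]

lemma octConj_octMul (a b : Fin 8 → F) :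
    octConj (octMul a b) = octMul (octConj b) (octConj a) := by
  funext i
  fin_cases i <;> simp [octConj, octMul] <;> ring

lemma octN_octConj (a : Fin 8 → F) : octN (octConj a) = octN a := by
  simp [octConj, octN]
  ring

lemma octConj_zero : octConj (0 : Fin 8 → F) = 0 := by
  funext i
  fin_cases i <;> simp [octConj]

lemma octConj_eq_zero {a : Fin 8 → F} : octConj a = 0 ↔ a = 0 := by
  refine ⟨fun h => ?_, fun h => by rw [h, octConj_zero]⟩
  rw [← octConj_octConj a, h, octConj_zero]

lemma octMul_zero (a : Fin 8 → F) : octMul a 0 = 0 := by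
  funext i
  fin_cases i <;> simp [octMul]

lemma zero_octMul (a : Fin 8 → F) : octMul 0 a = 0 := by
  funext i
  fin_cases i <;> simp [octMul]

lemma octN_zero : octN (0 : Fin 8 → F) = 0 := by
  simp [octN]

/-- Left multiplication by an octonion. -/
def octLeft (a : Fin 8 → F) : (Fin 8 → F) →ₗ[F] (Fin 8 → F) where
  toFun := octMul a
  map_add' x y := by
    funext i
    fin_cases i <;> simp [octMul] <;> ring
  map_smul' c x := by
    funext i
    fin_cases i <;> simp [octMul] <;> ring

/-- Right multiplication by an octonion. -/
def octRight (a : Fin 8 → F) : (Fin 8 → F) →ₗ[F] (Fin 8 → F) where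
  toFun x := octMul x a
  map_add' x y := by
    funext i
    fin_cases i <;> simp [octMul] <;> ring
  map_smul' c x := by
    funext i
    fin_cases i <;> simp [octMul] <;> ring

/-- Octonion conjugation as a linear equivalence. -/
def octConjEquiv : (Fin 8 → F) ≃ₗ[F] (Fin 8 → F) where
  toFun := octConj
  invFun := octConj
  left_inv := octConj_octConj
  right_inv := octConj_octConj
  map_add' x y := by
    funext i
    fin_cases i <;> simp [octConj] <;> ring
  map_smul' c x := by
    funext i
    fin_cases i <;> simp [octConj]

@[simp]
lemma octLeft_apply (a b : Fin 8 → F) : octLeft a b = octMul a b := rfl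

@[simp]
lemma octRight_apply (a b : Fin 8 → F) : octRight a b = octMul b a := rfl

lemma octMul_conj_mul_add (x y z : Fin 8 → F) :
    octMul (octConj x) (octMul y z) + octMul (octConj y) (octMul x z) = octB x y • z := by
  rw [octB_eq]
  funext i
  fin_cases i <;> simp [octConj, octMul] <;> ring

lemma octMul_mul_conj_add (x y z : Fin 8 → F) :
    octMul (octMul z y) (octConj x) + octMul (octMul z x) (octConj y) = octB x y • z := by
  rw [octB_eq]
  funext i
  fin_cases i <;> simp [octConj, octMul] <;> ring

lemma octMul_conj_mul (x z : Fin 8 → F) :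
    octMul (octConj x) (octMul x z) = octN x • z := by
  funext i
  fin_cases i <;> simp [octConj, octMul, octN] <;> ring

lemma octMul_mul_conj (x z : Fin 8 → F) :
    octMul (octMul z x) (octConj x) = octN x • z := by
  funext i
  fin_cases i <;> simp [octConj, octMul, octN] <;> ring

lemma octMul_moufang (a x y : Fin 8 → F) :
    octMul (octMul a y) (octMul x a) =
      octB (octConj a) (octMul y x) • a - octN a • octConj (octMul y x) := by
  rw [octB_eq]
  funext i
  fin_cases i <;> simp [octConj, octMul, octN] <;> ring

lemma octB_octMul_right (a x y : Fin 8 → F) :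
    octB a (octMul y x) = octB (octMul (octConj y) a) x := by
  rw [octB_eq, octB_eq]
  simp [octConj, octMul]
  ring

lemma exists_octB_eq_one {a : Fin 8 → F} (ha : a ≠ 0) : ∃ u, octB a u = 1 := by
  obtain ⟨i, hi⟩ := Function.ne_iff.mp ha
  refine ⟨Pi.single (Fin.rev i) (a i)⁻¹, ?_⟩
  rw [octB_eq]
  fin_cases i <;> simp_all [Fin.rev]

lemma exists_octN_ne_zero_octB_eq_zero (e : Fin 8 → F) :
    ∃ a, octN a ≠ 0 ∧ octB a e = 0 := by
  simp only [octB_eq, octN]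
  by_cases h0 : e 0 = 0 <;> by_cases h7 : e 7 = 0
  · exact ⟨![1, 0, 0, 0, 0, 0, 0, 1], by simp, by simp [h0, h7]⟩
  · exact ⟨![-(e 1 + e 6) / e 7, 1, 0, 0, 0, 0, 1, 0], by simp, by simp [h0]; field_simp; ring⟩
  · exact ⟨![0, 1, 0, 0, 0, 0, 1, -(e 1 + e 6) / e 0], by simp, by simp [h7]; field_simp; ring⟩
  · exact ⟨![e 0, 0, 0, 0, 0, 0, 0, -e 7], by simp [h0, h7], by simp; ring⟩

end Octonions

section Kernels

variable [Field F]

lemma octN_eq_zero_of_octMul_eq_zero {a b : Fin 8 → F} (ha : a ≠ 0) (h : octMul a b = 0) :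
    octN b = 0 := by
  have := octMul_mul_conj b a
  rw [h, zero_octMul] at this
  exact (smul_eq_zero.mp this.symm).resolve_right ha

lemma octN_eq_zero_of_octMul_eq_zero' {a b : Fin 8 → F} (ha : a ≠ 0) (h : octMul b a = 0) :
    octN b = 0 := by
  rw [← octN_octConj]
  apply octN_eq_zero_of_octMul_eq_zero (mt octConj_eq_zero.mp ha)
  rw [← octConj_octMul, h, octConj_zero]

lemma exists_eq_conj_octMul {a b : Fin 8 → F} (ha : a ≠ 0) (h : octMul a b = 0) :
    ∃ c, b = octMul (octConj a) c := by
  obtain ⟨u, hu⟩ := exists_octB_eq_one ha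
  have := octMul_conj_mul_add a u b
  rw [h, octMul_zero, add_zero, hu, one_smul] at this
  exact ⟨_, this.symm⟩

lemma exists_eq_octMul_conj {a b : Fin 8 → F} (ha : a ≠ 0) (h : octMul b a = 0) :
    ∃ c, b = octMul c (octConj a) := by
  obtain ⟨u, hu⟩ := exists_octB_eq_one ha
  have := octMul_mul_conj_add a u b
  rw [h, zero_octMul, add_zero, hu, one_smul] at this
  exact ⟨_, this.symm⟩

lemma range_octLeft {a : Fin 8 → F} (ha : a ≠ 0) (hN : octN a = 0) :
    LinearMap.range (octLeft a) = LinearMap.ker (octLeft (octConj a)) := by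
  ext b
  simp only [LinearMap.mem_range, LinearMap.mem_ker, octLeft_apply]
  constructor
  · rintro ⟨c, rfl⟩
    rw [octMul_conj_mul, hN, zero_smul]
  · intro h
    obtain ⟨c, hc⟩ := exists_eq_conj_octMul (mt octConj_eq_zero.mp ha) h
    exact ⟨c, by rw [hc, octConj_octConj]⟩

lemma finrank_ker_octLeft_conj_le {a : Fin 8 → F} :
    Module.finrank F (LinearMap.ker (octLeft (octConj a))) ≤
      Module.finrank F (LinearMap.ker (octLeft a)) := by
  obtain ⟨p, hp, hpa⟩ := exists_octN_ne_zero_octB_eq_zero (octConj a)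
  have hinj {b : Fin 8 → F} (h : octMul p b = 0) : b = 0 := by
    have := octMul_conj_mul p b
    rw [h, octMul_zero] at this
    exact (smul_eq_zero.mp this.symm).resolve_left hp
  have hmaps (b : Fin 8 → F) (hb : b ∈ LinearMap.ker (octLeft (octConj a))) :
      octLeft p b ∈ LinearMap.ker (octLeft a) := by
    simp only [LinearMap.mem_ker, octLeft_apply] at hb ⊢
    apply hinj
    have h₂ : octB (octConj p) a = 0 := by
      rw [← hpa, octB_eq, octB_eq]
      simp [octConj]
      ring
    have h₃ := octMul_conj_mul_add (octConj p) a (octMul p b)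
    rw [octConj_octConj, h₂, zero_smul, octMul_conj_mul] at h₃
    have h₄ : octMul (octConj a) (octN p • b) = 0 := by
      rw [← octLeft_apply, map_smul, octLeft_apply, hb, smul_zero]
    rwa [h₄, add_zero] at h₃
  refine LinearMap.finrank_le_finrank_of_injective
    (f := (octLeft p).restrict hmaps) ?_
  rw [← LinearMap.ker_eq_bot, LinearMap.ker_eq_bot']
  rintro ⟨b, hb⟩ h
  exact Subtype.ext (hinj (congrArg Subtype.val h))

lemma finrank_ker_octLeft {a : Fin 8 → F} (ha : a ≠ 0) (hN : octN a = 0) :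
    Module.finrank F (LinearMap.ker (octLeft a)) = 4 := by
  have h := (octLeft a).finrank_range_add_finrank_ker
  rw [range_octLeft ha hN, Module.finrank_fin_fun] at h
  have h₁ := finrank_ker_octLeft_conj_le (a := a)
  have h₂ := finrank_ker_octLeft_conj_le (a := octConj a)
  rw [octConj_octConj] at h₂
  omega

lemma finrank_ker_octRight {a : Fin 8 → F} (ha : a ≠ 0) (hN : octN a = 0) :
    Module.finrank F (LinearMap.ker (octRight a)) = 4 := by
  rw [← finrank_ker_octLeft (mt octConj_eq_zero.mp ha) ((octN_octConj a).trans hN)]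
  have : LinearMap.ker (octRight a) =
      (LinearMap.ker (octLeft (octConj a))).comap octConjEquiv.toLinearMap := by
    ext b
    have : octConjEquiv b = octConj b := rfl
    simp [this, ← octConj_octMul, octConj_eq_zero]
  rw [this]
  exact (LinearEquiv.ofSubmodule' octConjEquiv _).finrank_eq

/-- If `d`, `e` are nonzero null octonions with `d e = 0`, then `e` maps the right annihilator
`{x | x d = 0}` onto the line spanned by `octConj d`. -/
lemma range_octLeft_domRestrict {d e : Fin 8 → F} (hd : d ≠ 0) (he : e ≠ 0) (hN : octN d = 0)
    (h : octMul d e = 0) :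
    LinearMap.range ((octLeft e).domRestrict (LinearMap.ker (octRight d))) =
      Submodule.span F {octConj d} := by
  obtain ⟨y, hy⟩ := exists_eq_conj_octMul hd h
  have key (x : Fin 8 → F) :
      octMul e (octMul x (octConj d)) = octB d (octMul y x) • octConj d := by
    rw [hy, octMul_moufang, octConj_octConj, octN_octConj, hN, zero_smul, sub_zero]
  apply le_antisymm
  · rintro _ ⟨⟨g, hg⟩, rfl⟩
    obtain ⟨x, rfl⟩ := exists_eq_octMul_conj hd hg
    simp only [LinearMap.domRestrict_apply, octLeft_apply, key]
    exact Submodule.smul_mem _ _ (Submodule.mem_span_singleton_self _)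
  · rw [Submodule.span_singleton_le_iff_mem]
    obtain ⟨x, hx⟩ := exists_octB_eq_one (mt octConj_eq_zero.mp he)
    refine ⟨⟨octMul x (octConj d), ?_⟩, ?_⟩
    · have := octMul_mul_conj (octConj d) x
      rw [octConj_octConj, octN_octConj, hN, zero_smul] at this
      exact this
    · simp only [LinearMap.domRestrict_apply, octLeft_apply, key]
      rw [octB_octMul_right]
      have : octMul (octConj y) d = octConj e := by rw [hy, octConj_octMul, octConj_octConj]
      rw [this, hx, one_smul]

lemma finrank_ker_octLeft_inf_ker_octRight {d e : Fin 8 → F} (hd : d ≠ 0) (he : e ≠ 0)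
    (hN : octN d = 0) (h : octMul d e = 0) :
    Module.finrank F
      (LinearMap.ker (octLeft e) ⊓ LinearMap.ker (octRight d) : Submodule F (Fin 8 → F)) = 3 := by
  have h₁ := ((octLeft e).domRestrict
    (LinearMap.ker (octRight d))).finrank_range_add_finrank_ker
  rw [range_octLeft_domRestrict hd he hN h, finrank_ker_octRight hd hN,
    finrank_span_singleton (mt octConj_eq_zero.mp hd), LinearMap.ker_domRestrict] at h₁
  rw [inf_comm, ← Submodule.map_comap_subtype,
    LinearEquiv.finrank_eq
      (Submodule.equivMapOfInjective _ (Submodule.injective_subtype _) _).symm]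
  omega

end Kernels

section Counting

open Finset
open scoped Classical

lemma card_filter_prod_eq_sum {α β : Type*} [Fintype α] [Fintype β] (R : α → β → Prop)
    [∀ a b, Decidable (R a b)] :
    #{x : α × β | R x.1 x.2} = ∑ a, #{b | R a b} := by
  simp only [card_filter, Fintype.sum_prod_type]

/-- Count pairs satisfying a relation whose fibres have a constant size, except over `a₀`. -/
lemma card_filter_prod_of_fibers {α β : Type*} [Fintype α] [Fintype β] {R : α → β → Prop}
    {P : α → Prop} [∀ a b, Decidable (R a b)] [DecidablePred P] {a₀ : α} {m n : ℤ} (hP : P a₀) (h₀ : (#{b | R a₀ b} : ℤ) = m)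
    (h₁ : ∀ a, a ≠ a₀ → P a → (#{b | R a b} : ℤ) = n) (h₂ : ∀ a b, R a b → P a) :
    (#{x : α × β | R x.1 x.2} : ℤ) = m + (#{a | P a} - 1) * n := by
  have h (a : α) : (#{b | R a b} : ℤ) =
      (if P a then n else 0) + if a = a₀ then m - n else 0 := by
    by_cases ha : a = a₀
    · subst ha
      simp [hP, h₀]
    · by_cases hPa : P a
      · simp [ha, hPa, h₁]
      · have : ∀ b, ¬ R a b := fun b hb => hPa (h₂ a b hb)
        simp [ha, hPa, this]
  rw [card_filter_prod_eq_sum, Nat.cast_sum, sum_congr rfl fun a _ => h a, sum_add_distrib,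
    sum_ite_eq', ← sum_filter, sum_const, nsmul_eq_mul]
  simp
  ring

/-- The number of lines spanned by the vectors of a set of nonzero vectors that is closed under
nonzero scalars. -/
lemma ncard_span_mul {K V : Type*} [Field K] [Fintype K] [AddCommGroup V] [Module K V]
    [Fintype V] {p : V → Prop} [DecidablePred p] (h₀ : ¬ p 0) (hsmul : ∀ (c : K) v, c ≠ 0 → p v → p (c • v)) :
    {P : Submodule K V | ∃ v, p v ∧ P = Submodule.span K {v}}.ncard * (Fintype.card K - 1) =
      #{v | p v} := by
  have himage : {P : Submodule K V | ∃ v, p v ∧ P = Submodule.span K {v}} =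
      ((univ.filter p).image fun v => Submodule.span K {v} : Finset (Submodule K V)) := by
    ext P
    simp [eq_comm]
  rw [himage, Set.ncard_coe_finset, card_eq_sum_card_image (fun v => Submodule.span K {v})
    (univ.filter p), ← smul_eq_mul, ← sum_const]
  refine sum_congr rfl fun P hP => ?_
  obtain ⟨v, hv, rfl⟩ := mem_image.mp hP
  replace hv : p v := (mem_filter.mp hv).2
  have hv₀ : v ≠ 0 := by
    rintro rfl
    exact h₀ hv
  rw [← Fintype.card_units, ← card_univ]
  refine card_bij (fun c _ => c • v) (fun c _ => ?_) (fun c _ d _ h => ?_) fun w hw => ?_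
  · simp only [mem_filter]
    exact ⟨⟨mem_univ _, hsmul c v c.ne_zero hv⟩,
      (Submodule.span_singleton_eq_span_singleton.mpr ⟨c, rfl⟩).symm⟩
  · exact Units.ext (smul_left_injective K hv₀ h)
  · obtain ⟨c, hc⟩ := Submodule.span_singleton_eq_span_singleton.mp (mem_filter.mp hw).2.symm
    exact ⟨c, mem_univ _, hc⟩

variable [Field F] [Fintype F]

lemma card_filter_mul_eq (c : F) :
    (#{p : F × F | p.1 * p.2 = c} : ℤ) =
      Fintype.card F - 1 + if c = 0 then (Fintype.card F : ℤ) else 0 := by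
  rw [card_filter_prod_of_fibers (R := fun a b => a * b = c) (P := fun _ => True) (a₀ := 0)
    (m := if c = 0 then (Fintype.card F : ℤ) else 0) (n := 1) trivial ?_ ?_ fun _ _ _ => trivial]
  · simp
    ring
  · by_cases hc : c = 0
    · simp [hc]
    · simp [hc, Ne.symm hc]
  · intro a ha _
    have : (univ.filter fun b => a * b = c) = {a⁻¹ * c} := by
      ext b
      simp [eq_inv_mul_iff_mul_eq₀ ha]
    rw [this, card_singleton, Nat.cast_one]

/-- The number of solutions of `∑ aᵢ bᵢ = c`. -/
lemma card_hyperbolic (n : ℕ) (c : F) :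
    (#{x : Fin n → F × F | ∑ i, (x i).1 * (x i).2 = c} : ℤ) * Fintype.card F =
      Fintype.card F ^ (2 * n) - Fintype.card F ^ n +
        if c = 0 then (Fintype.card F : ℤ) ^ (n + 1) else 0 := by
  induction n generalizing c with
  | zero => by_cases hc : c = 0 <;> simp [hc, Ne.symm]
  | succ n ih =>
    have h : #{x : Fin (n + 1) → F × F | ∑ i, (x i).1 * (x i).2 = c} =
        #{x : (F × F) × (Fin n → F × F) |
          ∑ i, (x.2 i).1 * (x.2 i).2 = c - x.1.1 * x.1.2} := by
      refine card_equiv (Fin.consEquiv fun _ => F × F).symm fun x => ?_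
      simp [Fin.consEquiv, Fin.sum_univ_succ, Fin.tail, eq_sub_iff_add_eq']
    rw [h, card_filter_prod_eq_sum (fun (p : F × F) (y : Fin n → F × F) =>
      ∑ i, (y i).1 * (y i).2 = c - p.1 * p.2), Nat.cast_sum, sum_mul,
      sum_congr rfl fun p _ => ih _, sum_add_distrib, ← sum_filter, sum_const, sum_const]
    have hc (p : F × F) : c - p.1 * p.2 = 0 ↔ p.1 * p.2 = c := by rw [sub_eq_zero, eq_comm]
    simp only [hc, nsmul_eq_mul, card_filter_mul_eq, card_univ,
      Fintype.card_prod]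
    push_cast
    split_ifs <;> ring

lemma card_octN_eq (c : F) :
    (#{a : Fin 8 → F | octN a = c} : ℤ) =
      Fintype.card F ^ 7 - Fintype.card F ^ 3 +
        if c = 0 then (Fintype.card F : ℤ) ^ 4 else 0 := by
  have h : #{a : Fin 8 → F | octN a = c} =
      #{x : Fin 4 → F × F | ∑ i, (x i).1 * (x i).2 = c} := by
    refine card_nbij' (fun a => ![(a 0, a 7), (a 1, a 6), (a 2, a 5), (a 3, a 4)])
      (fun x => ![(x 0).1, (x 1).1, (x 2).1, (x 3).1, (x 3).2, (x 2).2, (x 1).2, (x 0).2])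
      ?_ ?_ ?_ ?_
    · intro a ha
      simpa [octN, Fin.sum_univ_succ, add_assoc] using ha
    · intro x hx
      simpa [octN, Fin.sum_univ_succ, add_assoc] using hx
    · intro a _
      funext i
      fin_cases i <;> rfl
    · intro x _
      funext i
      fin_cases i <;> rfl
  have hq : (Fintype.card F : ℤ) ≠ 0 := by exact_mod_cast Fintype.card_ne_zero
  apply mul_right_cancel₀ hq
  rw [h, card_hyperbolic]
  split_ifs <;> ring

lemma card_octN_eq_zero_last :
    (#{a : Fin 8 → F | octN a = 0 ∧ a 7 = 0} : ℤ) =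
      Fintype.card F ^ 6 + Fintype.card F ^ 4 - Fintype.card F ^ 3 := by
  have h : #{a : Fin 8 → F | octN a = 0 ∧ a 7 = 0} =
      #((univ : Finset F) ×ˢ
        univ.filter fun x : Fin 3 → F × F => ∑ i, (x i).1 * (x i).2 = 0) := by
    refine card_nbij' (fun a => (a 0, ![(a 1, a 6), (a 2, a 5), (a 3, a 4)]))
      (fun x => ![x.1, (x.2 0).1, (x.2 1).1, (x.2 2).1, (x.2 2).2, (x.2 1).2, (x.2 0).2, 0])
      ?_ ?_ ?_ ?_
    · intro a ha
      obtain ⟨h, h₇⟩ := (mem_filter.mp ha).2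
      simpa [octN, h₇, Fin.sum_univ_succ, add_assoc] using h
    · intro x hx
      simpa [octN, Fin.sum_univ_succ, add_assoc] using hx
    · intro a ha
      have h₇ := (mem_filter.mp ha).2.2
      funext i
      fin_cases i <;> simp [h₇]
    · intro x _
      refine Prod.ext rfl (funext fun i => ?_)
      fin_cases i <;> rfl
  rw [h, card_product, Nat.cast_mul, mul_comm, card_univ, card_hyperbolic]
  simp
  ring

lemma card_octN_add_octN :
    (#{x : (Fin 8 → F) × (Fin 8 → F) | octN x.1 + octN x.2 + 1 = 0 ∧ x.2 7 = 0} : ℤ) =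
      Fintype.card F ^ 14 - Fintype.card F ^ 7 := by
  have h : #{x : (Fin 8 → F) × (Fin 8 → F) | octN x.1 + octN x.2 + 1 = 0 ∧ x.2 7 = 0} =
      #((univ : Finset F) ×ˢ
        univ.filter fun x : Fin 7 → F × F => ∑ i, (x i).1 * (x i).2 = -1) := by
    refine card_nbij' (fun x => (x.2 0, ![(x.1 0, x.1 7), (x.1 1, x.1 6), (x.1 2, x.1 5),
        (x.1 3, x.1 4), (x.2 1, x.2 6), (x.2 2, x.2 5), (x.2 3, x.2 4)]))
      (fun x => (![(x.2 0).1, (x.2 1).1, (x.2 2).1, (x.2 3).1,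
          (x.2 3).2, (x.2 2).2, (x.2 1).2, (x.2 0).2],
        ![x.1, (x.2 4).1, (x.2 5).1, (x.2 6).1, (x.2 6).2, (x.2 5).2, (x.2 4).2, 0]))
      ?_ ?_ ?_ ?_
    · intro x hx
      obtain ⟨h, h₇⟩ := (mem_filter.mp hx).2
      simp only [octN, h₇] at h
      simp [Fin.sum_univ_succ]
      linear_combination h
    · intro x hx
      have h := (mem_filter.mp (mem_product.mp hx).2).2
      simp [Fin.sum_univ_succ] at h
      refine mem_filter.mpr ⟨mem_univ _, ?_, rfl⟩
      simp [octN]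
      linear_combination h
    · intro x hx
      have h₇ := (mem_filter.mp hx).2.2
      refine Prod.ext (funext fun i => ?_) (funext fun i => ?_) <;> fin_cases i <;> simp [h₇]
    · intro x _
      refine Prod.ext rfl (funext fun i => ?_)
      fin_cases i <;> rfl
  rw [h, card_product, Nat.cast_mul, mul_comm, card_univ, card_hyperbolic]
  simp

end Counting

section WhiteVectors

open Finset
open scoped Classical

variable [Field F]

/-- The relation on triples of octonions defining the white vectors of the third kind. -/
def IsNullTriple (D E G : Fin 8 → F) : Prop :=
  octN D = 0 ∧ octN E = 0 ∧ octN G = 0 ∧ octMul D E = 0 ∧ octMul E G = 0 ∧ octMul G D = 0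

lemma IsWhite.ne_zero {v : Alb F} (h : IsWhite v) : v ≠ 0 := by
  rintro rfl
  obtain ⟨f, hf, _, _, _, h⟩ | ⟨e, he, _, _, _, _, h⟩ | ⟨D, E, G, hne, _, _, _, _, _, _, h⟩ := h
  · exact hf (congrArg (fun v => v.2.2.1) h).symm
  · exact he (congrArg (fun v => v.2.1) h).symm
  · exact hne (by simpa [Prod.ext_iff, eq_comm] using h)

lemma IsWhite.smul {v : Alb F} {c : F} (hc : c ≠ 0) (h : IsWhite v) : IsWhite (c • v) := by
  have hN (a : Fin 8 → F) (ha : octN a = 0) : octN (c • a) = 0 := by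
    have : octN (c • a) = c ^ 2 * octN a := by
      simp [octN]
      ring
    rw [this, ha, mul_zero]
  have hmul (a b : Fin 8 → F) (hab : octMul a b = 0) : octMul (c • a) (c • b) = 0 := by
    rw [← octLeft_apply, map_smul, octLeft_apply, ← octRight_apply, map_smul, octRight_apply,
      hab, smul_zero, smul_zero]
  obtain ⟨f, hf, A, B, hAB, rfl⟩ | ⟨e, he, A, C, hA, hC, rfl⟩ |
    ⟨D, E, G, hne, hD, hE, hG, hDE, hEG, hGD, rfl⟩ := h
  · exact Or.inl ⟨c * f, mul_ne_zero hc hf, A, B, hAB, by simp [mul_smul, mul_assoc]⟩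
  · exact Or.inr (Or.inl ⟨c * e, mul_ne_zero hc he, A, C, hA, hC, by simp [mul_smul, mul_assoc]⟩)
  · exact Or.inr (Or.inr ⟨c • D, c • E, c • G, by simpa [hc] using hne, hN D hD, hN E hE, hN G hG,
      hmul D E hDE, hmul E G hEG, hmul G D hGD, by simp⟩)

lemma albB_octX1 (v : Alb F) : albB (0, 0, 0, octX1, 0, 0) v = v.2.2.2.1 7 := by
  simp [albB, albQ, octN, octX1]
  ring

variable [Fintype F]

lemma card_mem_submodule (S : Submodule F (Fin 8 → F)) {p : (Fin 8 → F) → Prop}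
    [DecidablePred p] (hp : ∀ x, p x ↔ x ∈ S) :
    (#{x | p x} : ℤ) = Fintype.card F ^ Module.finrank F S := by
  rw [← Nat.cast_pow, ← Module.card_eq_pow_finrank (K := F) (V := S), Fintype.card_subtype]
  simp only [hp]

lemma card_octMul_left_eq_zero {a : Fin 8 → F} (ha : a ≠ 0) (hN : octN a = 0) :
    (#{b | octMul a b = 0} : ℤ) = Fintype.card F ^ 4 := by
  rw [card_mem_submodule (LinearMap.ker (octLeft a)) (p := fun b => octMul a b = 0)
    fun _ => Iff.rfl, finrank_ker_octLeft ha hN]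

lemma card_octMul_right_eq_zero {a : Fin 8 → F} (ha : a ≠ 0) (hN : octN a = 0) :
    (#{b | octMul b a = 0} : ℤ) = Fintype.card F ^ 4 := by
  rw [card_mem_submodule (LinearMap.ker (octRight a)) (p := fun b => octMul b a = 0)
    fun _ => Iff.rfl, finrank_ker_octRight ha hN]

lemma card_isNullTriple_zero :
    (#{x : (Fin 8 → F) × (Fin 8 → F) | IsNullTriple 0 x.1 x.2} : ℤ) =
      (Fintype.card F ^ 7 + Fintype.card F ^ 4 - Fintype.card F ^ 3) +
        (Fintype.card F ^ 7 + Fintype.card F ^ 4 - Fintype.card F ^ 3 - 1) *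
          Fintype.card F ^ 4 := by
  have h₀ := card_octN_eq (0 : F)
  rw [if_pos rfl] at h₀
  rw [card_filter_prod_of_fibers (R := IsNullTriple (0 : Fin 8 → F)) (P := fun e => octN e = 0)
    (a₀ := 0) (n := Fintype.card F ^ 4) octN_zero rfl ?_ fun _ _ h => h.2.1]
  · simp only [IsNullTriple, octN_zero, octMul_zero, zero_octMul, true_and, and_true, h₀]
    ring
  · intro e he hN
    rw [← card_octMul_left_eq_zero he hN]
    congr 3
    ext g
    simp only [IsNullTriple, octN_zero, octMul_zero, zero_octMul, true_and, and_true, hN]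
    exact and_iff_right_of_imp (octN_eq_zero_of_octMul_eq_zero he)

lemma card_isNullTriple {d : Fin 8 → F} (hd : d ≠ 0) (hN : octN d = 0) :
    (#{x : (Fin 8 → F) × (Fin 8 → F) | IsNullTriple d x.1 x.2} : ℤ) =
      Fintype.card F ^ 4 + (Fintype.card F ^ 4 - 1) * Fintype.card F ^ 3 := by
  rw [card_filter_prod_of_fibers (R := IsNullTriple d) (P := fun e => octMul d e = 0)
    (a₀ := 0) (m := Fintype.card F ^ 4) (n := Fintype.card F ^ 3) (octMul_zero d) ?_ ?_
    fun _ _ h => h.2.2.2.1, card_octMul_left_eq_zero hd hN]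
  · rw [← card_octMul_right_eq_zero hd hN]
    congr 3
    ext g
    simp only [IsNullTriple, octN_zero, octMul_zero, zero_octMul, true_and, hN]
    exact and_iff_right_of_imp (octN_eq_zero_of_octMul_eq_zero' hd)
  · intro e he h
    rw [card_mem_submodule (LinearMap.ker (octLeft e) ⊓ LinearMap.ker (octRight d)),
      finrank_ker_octLeft_inf_ker_octRight hd he hN h]
    intro g
    simp only [IsNullTriple, hN, h, octN_eq_zero_of_octMul_eq_zero hd h, true_and,
      Submodule.mem_inf, LinearMap.mem_ker, octLeft_apply, octRight_apply]
    exact and_iff_right_of_imp fun h => octN_eq_zero_of_octMul_eq_zero he h.1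

lemma card_isNullTriple_last :
    (#{x : (Fin 8 → F) × (Fin 8 → F) × (Fin 8 → F) |
        IsNullTriple x.1 x.2.1 x.2.2 ∧ x.1 7 = 0} : ℤ) =
      (Fintype.card F ^ 7 + Fintype.card F ^ 4 - Fintype.card F ^ 3) +
        (Fintype.card F ^ 7 + Fintype.card F ^ 4 - Fintype.card F ^ 3 - 1) *
          Fintype.card F ^ 4 +
      (Fintype.card F ^ 6 + Fintype.card F ^ 4 - Fintype.card F ^ 3 - 1) *
        (Fintype.card F ^ 4 + (Fintype.card F ^ 4 - 1) * Fintype.card F ^ 3) := by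
  rw [card_filter_prod_of_fibers
    (R := fun (d : Fin 8 → F) (x : (Fin 8 → F) × (Fin 8 → F)) =>
      IsNullTriple d x.1 x.2 ∧ d 7 = 0)
    (P := fun d => octN d = 0 ∧ d 7 = 0) (a₀ := 0) ⟨octN_zero, rfl⟩ ?_ ?_
    fun _ _ h => ⟨h.1.1, h.2⟩, card_octN_eq_zero_last]
  · simp only [Pi.zero_apply, and_true, card_isNullTriple_zero]
  · intro d hd h
    simp only [h.2, and_true, card_isNullTriple hd h.1]

lemma card_ne_zero_eq : #{c : F | c ≠ 0} = Fintype.card F - 1 := by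
  rw [filter_ne', card_erase_of_mem (mem_univ _), card_univ]

lemma card_isWhite_first :
    #{v : Alb F | (IsWhite v ∧ v.2.2.2.1 7 = 0) ∧ v.2.2.1 ≠ 0} =
      (Fintype.card F - 1) *
        #{x : (Fin 8 → F) × (Fin 8 → F) | octN x.1 + octN x.2 + 1 = 0 ∧ x.2 7 = 0} := by
  rw [← card_ne_zero_eq, ← card_product]
  symm
  refine card_bij (fun x _ => (x.1 * octN x.2.1, x.1 * octN x.2.2, x.1, x.1 • octConj x.2.2,
    x.1 • x.2.1, x.1 • octMul (octConj x.2.1) x.2.2)) ?_ ?_ ?_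
  · rintro ⟨f, A, B⟩ h
    simp only [mem_product, mem_filter_univ] at h ⊢
    exact ⟨⟨Or.inl ⟨f, h.1, A, B, h.2.1, rfl⟩, by simp [octConj, h.2.2]⟩, h.1⟩
  · rintro ⟨f, A, B⟩ h ⟨f', A', B'⟩ _ heq
    simp only [mem_product, mem_filter_univ] at h
    simp only [Prod.mk.injEq] at heq
    obtain ⟨-, -, rfl, hB, hA, -⟩ := heq
    have hf := smul_right_injective (Fin 8 → F) h.1
    rw [hf hA, ← octConj_octConj B, hf hB, octConj_octConj]
  · intro v hv
    obtain ⟨⟨hw, h₇⟩, h⟩ := (mem_filter.mp hv).2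
    obtain ⟨f, hf, A, B, hN, rfl⟩ | ⟨_, _, _, _, _, _, rfl⟩ | ⟨_, _, _, _, _, _, _, _, _, _, rfl⟩ :=
      hw
    · refine ⟨(f, A, B), ?_, rfl⟩
      simp only [mem_product, mem_filter_univ]
      exact ⟨hf, hN, by simpa [octConj, hf] using h₇⟩
    · exact absurd rfl h
    · exact absurd rfl h

lemma card_isWhite_second :
    #{v : Alb F | ((IsWhite v ∧ v.2.2.2.1 7 = 0) ∧ v.2.2.1 = 0) ∧ v.2.1 ≠ 0} =
      (Fintype.card F - 1) *
        (#{A : Fin 8 → F | octN A = 0 ∧ A 7 = 0} * #{C : Fin 8 → F | octN C = -1}) := by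
  rw [← card_ne_zero_eq, ← card_product, ← card_product]
  symm
  refine card_bij (fun x _ => (x.1 * octN x.2.2, x.1, 0, x.1 • x.2.1,
    x.1 • octConj (octMul x.2.2 x.2.1), x.1 • x.2.2)) ?_ ?_ ?_
  · rintro ⟨e, A, C⟩ h
    simp only [mem_product, mem_filter_univ] at h ⊢
    exact ⟨⟨⟨Or.inr (Or.inl ⟨e, h.1, A, C, h.2.1.1, eq_neg_iff_add_eq_zero.mp h.2.2, rfl⟩),
      by simp [h.2.1.2]⟩, trivial⟩, h.1⟩
  · rintro ⟨e, A, C⟩ h ⟨e', A', C'⟩ _ heq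
    simp only [mem_product, mem_filter_univ] at h
    simp only [Prod.mk.injEq] at heq
    obtain ⟨-, rfl, -, hA, -, hC⟩ := heq
    have he := smul_right_injective (Fin 8 → F) h.1
    rw [he hA, he hC]
  · intro v hv
    obtain ⟨⟨⟨hw, h₇⟩, h₀⟩, h⟩ := (mem_filter.mp hv).2
    obtain ⟨f, hf, _, _, _, rfl⟩ | ⟨e, he, A, C, hA, hC, rfl⟩ |
      ⟨_, _, _, _, _, _, _, _, _, _, rfl⟩ := hw
    · exact absurd h₀ hf
    · refine ⟨(e, A, C), ?_, rfl⟩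
      simp only [mem_product, mem_filter_univ]
      exact ⟨he, ⟨hA, by simpa [he] using h₇⟩, eq_neg_iff_add_eq_zero.mpr hC⟩
    · exact absurd rfl h

lemma card_isWhite_third :
    #{v : Alb F | ((IsWhite v ∧ v.2.2.2.1 7 = 0) ∧ v.2.2.1 = 0) ∧ ¬ v.2.1 ≠ 0} + 1 =
      #{x : (Fin 8 → F) × (Fin 8 → F) × (Fin 8 → F) |
        IsNullTriple x.1 x.2.1 x.2.2 ∧ x.1 7 = 0} := by
  have hzero : (0 : (Fin 8 → F) × (Fin 8 → F) × (Fin 8 → F)) ∈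
      univ.filter fun x => IsNullTriple x.1 x.2.1 x.2.2 ∧ x.1 7 = 0 := by
    exact mem_filter.mpr ⟨mem_univ _, ⟨octN_zero, octN_zero, octN_zero, octMul_zero _,
      octMul_zero _, octMul_zero _⟩, rfl⟩
  rw [← card_erase_add_one hzero, add_left_inj]
  symm
  refine card_bij (fun x _ => (0, 0, 0, x)) ?_ ?_ ?_
  · rintro ⟨D, E, G⟩ h
    simp only [mem_erase, mem_filter_univ] at h
    obtain ⟨hne, ⟨hD, hE, hG, hDE, hEG, hGD⟩, h₇⟩ := h
    simp only [mem_filter_univ]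
    refine ⟨⟨⟨Or.inr (Or.inr ⟨D, E, G, ?_, hD, hE, hG, hDE, hEG, hGD, rfl⟩), h₇⟩, trivial⟩,
      by simp⟩
    rintro ⟨rfl, rfl, rfl⟩
    exact hne rfl
  · intro x _ y _ h
    simpa using h
  · intro v hv
    obtain ⟨⟨⟨hw, h₇⟩, h₀⟩, h⟩ := (mem_filter.mp hv).2
    obtain ⟨f, hf, _, _, _, rfl⟩ | ⟨e, he, A, C, hA, hC, rfl⟩ |
      ⟨D, E, G, hne, hD, hE, hG, hDE, hEG, hGD, rfl⟩ := hw
    · exact absurd h₀ hf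
    · exact absurd he h
    · refine ⟨(D, E, G), ?_, rfl⟩
      simp only [mem_erase, mem_filter_univ]
      exact ⟨by simpa using hne, ⟨hD, hE, hG, hDE, hEG, hGD⟩, h₇⟩

lemma card_isWhite_last :
    (#{v : Alb F | IsWhite v ∧ v.2.2.2.1 7 = 0} : ℤ) =
      (Fintype.card F - 1) * (Fintype.card F ^ 11 +
        (Fintype.card F ^ 4 + 1) * ∑ i ∈ range 11, (Fintype.card F : ℤ) ^ i) := by
  have h₁ := card_filter_add_card_filter_not (s := univ.filter fun v : Alb F =>
    IsWhite v ∧ v.2.2.2.1 7 = 0) fun v => v.2.2.1 ≠ 0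
  have h₂ := card_filter_add_card_filter_not (s := univ.filter fun v : Alb F =>
    (IsWhite v ∧ v.2.2.2.1 7 = 0) ∧ v.2.2.1 = 0) fun v => v.2.1 ≠ 0
  simp only [filter_filter, not_not] at h₁
  simp only [filter_filter] at h₂
  have h₃ := card_isWhite_third (F := F)
  rw [card_isWhite_first] at h₁
  rw [card_isWhite_second] at h₂
  have hC := card_octN_eq (-1 : F)
  rw [if_neg (by simp), add_zero] at hC
  zify [Fintype.card_pos (α := F)] at h₁ h₂ h₃
  rw [card_octN_add_octN] at h₁
  rw [card_octN_eq_zero_last, hC] at h₂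
  rw [card_isNullTriple_last] at h₃
  simp only [sum_range_succ, sum_range_zero]
  linear_combination h₃ - h₁ - h₂

end WhiteVectors

/-- Suppose `q ≡ 2 (mod 3)` and let `w = (0, 0, 0 | x_1, 0, 0) ∈ U`.
The number of white points `⟨v⟩` of `U` with `B_Q(w, v) = 0` equals
`q^{11} + (q^4 + 1)(q^{11} − 1)/(q − 1)`. -/
theorem stmt_8 {F : Type*} [Field F] [Fintype F] (hq : Fintype.card F % 3 = 2) :
    {P : Submodule F (Alb F) | ∃ v : Alb F, IsWhite v ∧
        albB (0, 0, 0, octX1, 0, 0) v = 0 ∧ P = Submodule.span F {v}}.ncard =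
      Fintype.card F ^ 11 +
        (Fintype.card F ^ 4 + 1) * (Fintype.card F ^ 11 - 1) / (Fintype.card F - 1) := by
  classical
  simp only [albB_octX1, ← and_assoc]
  have hq₁ : 1 < Fintype.card F := Fintype.one_lt_card
  have hgeom : Fintype.card F ^ 11 - 1 =
      (∑ i ∈ Finset.range 11, Fintype.card F ^ i) * (Fintype.card F - 1) := by
    zify [hq₁.le, Nat.one_le_pow 11 _ (zero_lt_one.trans hq₁)]
    rw [geom_sum_mul]
  rw [hgeom, ← mul_assoc, Nat.mul_div_cancel _ (Nat.sub_pos_of_lt hq₁)]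
  have hpoints := ncard_span_mul (K := F)
    (p := fun v : Alb F => IsWhite v ∧ v.2.2.2.1 7 = 0) (fun h => h.1.ne_zero rfl)
    fun c v hc h => ⟨h.1.smul hc, by simp [h.2]⟩
  apply Nat.eq_of_mul_eq_mul_right (Nat.sub_pos_of_lt hq₁)
  rw [hpoints]
  have hcard := card_isWhite_last (F := F)
  zify [hq₁.le]
  rw [mul_comm, ← hcard]
end

section
/- The number of pairs (A, B) ∈ O × O such that N(A) + N(B) + 1 = 0 and Tr(x_1·B) = 0 equals q^7(q^7 − 1). -/
/-!  The split octonion algebra `O` over a finite field `F` of order `q`,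
represented as `Fin 8 → F` with coordinates with respect to the basis
`x_1, …, x_8` (index `i : Fin 8` corresponds to `x_{i+1}`). -/

variable {F : Type*}

open scoped Matrix

/-- A nonzero vector `u` takes each prescribed dot product with exactly `q ^ n` vectors of
length `n + 1`. -/
theorem card_dotProduct_fiber {F : Type*} [Field F] [Fintype F] {n : ℕ} {u : Fin (n + 1) → F}
    (hu : u ≠ 0) (c : F) :
    Nat.card {v : Fin (n + 1) → F // u ⬝ᵥ v = c} = Fintype.card F ^ n := by
  classical
  obtain ⟨i, hi⟩ := Function.ne_iff.mp hu
  have hi' : u i ≠ 0 := hi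
  have translate (d : F) : Nat.card {v : Fin (n + 1) → F // u ⬝ᵥ v = d} =
      Nat.card {v : Fin (n + 1) → F // u ⬝ᵥ v = c} := by
    refine Nat.card_congr ((Equiv.addRight (Pi.single i ((u i)⁻¹ * (c - d)))).subtypeEquiv ?_)
    intro v
    simp only [Equiv.coe_addRight, dotProduct_add, dotProduct_single, mul_inv_cancel_left₀ hi']
    constructor <;> intro h <;> linear_combination h
  have total : Nat.card (Σ d : F, {v : Fin (n + 1) → F // u ⬝ᵥ v = d}) =
      Nat.card (Fin (n + 1) → F) :=
    Nat.card_congr (Equiv.sigmaFiberEquiv fun v : Fin (n + 1) → F => u ⬝ᵥ v)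
  rw [Nat.card_sigma, Finset.sum_congr rfl fun d _ => translate d] at total
  simp only [Finset.sum_const, Finset.card_univ, smul_eq_mul, Nat.card_fun,
    Nat.card_eq_fintype_card (α := F), Nat.card_eq_fintype_card (α := Fin (n + 1)),
    Fintype.card_fin, pow_succ'] at total
  exact Nat.eq_of_mul_eq_mul_left Fintype.card_pos total

/-- The number of pairs of vectors of length `n + 1` with a given nonzero dot product. -/
theorem card_dotProduct_eq {F : Type*} [Field F] [Fintype F] (n : ℕ) {c : F} (hc : c ≠ 0) :
    Nat.card {p : (Fin (n + 1) → F) × (Fin (n + 1) → F) // p.1 ⬝ᵥ p.2 = c} =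
      Fintype.card F ^ n * (Fintype.card F ^ (n + 1) - 1) := by
  classical
  rw [Nat.card_congr (Equiv.subtypeProdEquivSigmaSubtype
    fun u v : Fin (n + 1) → F => u ⬝ᵥ v = c), Nat.card_sigma]
  have fiber (u : Fin (n + 1) → F) : Nat.card {v : Fin (n + 1) → F // u ⬝ᵥ v = c} =
      if u ≠ 0 then Fintype.card F ^ n else 0 := by
    split_ifs with hu
    · exact card_dotProduct_fiber hu c
    · rw [not_not.mp hu]
      simp [hc.symm]
  rw [Finset.sum_congr rfl fun u _ => fiber u, ← Finset.sum_filter, Finset.sum_const,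
    Finset.filter_ne', Finset.card_erase_of_mem (Finset.mem_univ _), Finset.card_univ,
    Fintype.card_fun, Fintype.card_fin, smul_eq_mul, mul_comm]

theorem octTr_octMul_octX1 {F : Type*} [Field F] (b : Fin 8 → F) :
    octTr (octMul octX1 b) = -b 7 := by
  simp [octTr, octMul, octX1]

/-- Pairing off the hyperbolic planes of `N ⊕ N` restricted to the hyperplane
`Tr (x_1 B) = 0` gives a dot product on `F ^ 7`, the first coordinate of `B` being free. -/
def octPairEquiv (F : Type*) [Field F] :
    {p : (Fin 8 → F) × (Fin 8 → F) //
        octN p.1 + octN p.2 + 1 = 0 ∧ octTr (octMul octX1 p.2) = 0} ≃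
      F × {p : (Fin 7 → F) × (Fin 7 → F) // p.1 ⬝ᵥ p.2 = -1} where
  toFun p := (p.1.2 0,
    ⟨(![p.1.1 0, p.1.1 1, p.1.1 2, p.1.1 3, p.1.2 1, p.1.2 2, p.1.2 3],
      ![p.1.1 7, p.1.1 6, p.1.1 5, p.1.1 4, p.1.2 6, p.1.2 5, p.1.2 4]), by
      obtain ⟨⟨a, b⟩, h, hb⟩ := p
      rw [octTr_octMul_octX1, neg_eq_zero] at hb
      simp only [octN] at h hb
      simp [dotProduct, Fin.sum_univ_succ]
      linear_combination h - b 0 * hb⟩)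
  invFun p :=
    ⟨(![p.2.1.1 0, p.2.1.1 1, p.2.1.1 2, p.2.1.1 3, p.2.1.2 3, p.2.1.2 2, p.2.1.2 1, p.2.1.2 0],
      ![p.1, p.2.1.1 4, p.2.1.1 5, p.2.1.1 6, p.2.1.2 6, p.2.1.2 5, p.2.1.2 4, 0]), by
      obtain ⟨t, ⟨u, v⟩, h⟩ := p
      simp only [dotProduct, Fin.sum_univ_seven] at h
      rw [octTr_octMul_octX1]
      refine ⟨?_, by simp⟩
      simp [octN]
      linear_combination h⟩
  left_inv p := by
    obtain ⟨⟨a, b⟩, h, hb⟩ := p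
    rw [octTr_octMul_octX1, neg_eq_zero] at hb
    ext i
    · fin_cases i <;> rfl
    · fin_cases i <;> first | rfl | exact hb.symm
  right_inv p := by
    obtain ⟨t, ⟨u, v⟩, h⟩ := p
    ext i
    · rfl
    · fin_cases i <;> rfl
    · fin_cases i <;> rfl

/-- The number of pairs `(A, B) ∈ O × O` with `N(A) + N(B) + 1 = 0`
and `Tr(x_1·B) = 0` equals `q^7(q^7 − 1)`. -/
theorem stmt_9 {F : Type*} [Field F] [Fintype F] :
    Nat.card {p : (Fin 8 → F) × (Fin 8 → F) //
        octN p.1 + octN p.2 + 1 = 0 ∧ octTr (octMul octX1 p.2) = 0} =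
      Fintype.card F ^ 7 * (Fintype.card F ^ 7 - 1) := by
  rw [Nat.card_congr (octPairEquiv F), Nat.card_prod,
    card_dotProduct_eq 6 (neg_ne_zero.mpr one_ne_zero), Nat.card_eq_fintype_card,
    ← mul_assoc, ← pow_succ']
end

section
/- The number of pairs (A, C) ∈ O × O such that N(C) + 1 = 0, N(A) = 0 and Tr(x_1·Ā) = 0 equals (q^7 − q^3)(q^6 − q^3 + q^4). -/
/-!  The split octonion algebra `O` over a finite field `F` of order `q`,
represented as `Fin 8 → F` with coordinates with respect to the basis
`x_1, …, x_8` (index `i : Fin 8` corresponds to `x_{i+1}`). -/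

variable {F : Type*}

theorem natCard_dotProduct_fiber [Field F] [Fintype F] {n : ℕ} {x : Fin (n + 1) → F}
    (hx : x ≠ 0) (c : F) :
    Nat.card {y : Fin (n + 1) → F // x ⬝ᵥ y = c} = Fintype.card F ^ n := by
  obtain ⟨i, hi⟩ := Function.ne_iff.mp hx
  have hi : x i ≠ 0 := hi
  have e : {y : Fin (n + 1) → F // x ⬝ᵥ y = c} ≃ (Fin n → F) :=
    { toFun := fun y => i.removeNth y.1
      invFun := fun z =>
        ⟨i.insertNth ((x i)⁻¹ * (c - i.removeNth x ⬝ᵥ z)) z, by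
          simp [dotProduct, Fin.sum_univ_succAbove _ i, Fin.removeNth, hi]⟩
      left_inv := by
        rintro ⟨y, rfl⟩
        apply Subtype.ext
        conv_rhs => rw [← Fin.insertNth_self_removeNth i y]
        simp [dotProduct, Fin.sum_univ_succAbove _ i, Fin.removeNth, hi]
      right_inv := fun z => by simp }
  rw [Nat.card_congr e]
  simp [Nat.card_eq_fintype_card]

theorem natCard_dotProduct_eq [Field F] [Fintype F] (n : ℕ) (c : F) :
    Nat.card {p : (Fin (n + 1) → F) × (Fin (n + 1) → F) // p.1 ⬝ᵥ p.2 = c} =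
      Nat.card {_y : Fin (n + 1) → F // (0 : F) = c} +
        (Fintype.card F ^ (n + 1) - 1) * Fintype.card F ^ n := by
  classical
  rw [Nat.card_congr (Equiv.subtypeProdEquivSigmaSubtype
      fun (x y : Fin (n + 1) → F) => x ⬝ᵥ y = c), Nat.card_sigma,
    Fintype.sum_eq_add_sum_compl 0,
    Finset.sum_congr rfl fun x hx => natCard_dotProduct_fiber (by simpa using hx) c]
  simp [Finset.card_compl]

theorem natCard_octN_add_one_eq_zero [Field F] [Fintype F] :
    Nat.card {a : Fin 8 → F // octN a + 1 = 0} = Fintype.card F ^ 7 - Fintype.card F ^ 3 := by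
  have e : {a : Fin 8 → F // octN a + 1 = 0} ≃
      {p : (Fin 4 → F) × (Fin 4 → F) // p.1 ⬝ᵥ p.2 = -1} :=
    { toFun := fun a => ⟨(![a.1 0, a.1 1, a.1 2, a.1 3], ![a.1 7, a.1 6, a.1 5, a.1 4]), by
        have h := a.2
        simp only [octN] at h
        simp [dotProduct, Fin.sum_univ_four]
        linear_combination h⟩
      invFun := fun p =>
        ⟨![p.1.1 0, p.1.1 1, p.1.1 2, p.1.1 3, p.1.2 3, p.1.2 2, p.1.2 1, p.1.2 0], by
          have h := p.2
          simp only [dotProduct, Fin.sum_univ_four] at h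
          simp [octN]
          linear_combination h⟩
      left_inv := fun a => by
        ext i
        fin_cases i <;> rfl
      right_inv := fun p => by
        ext i <;> fin_cases i <;> rfl }
  rw [Nat.card_congr e, natCard_dotProduct_eq]
  simp [Nat.sub_mul, ← pow_add]

theorem natCard_octN_eq_zero_and_eq_zero [Field F] [Fintype F] :
    Nat.card {a : Fin 8 → F // octN a = 0 ∧ a 7 = 0} =
      Fintype.card F ^ 6 - Fintype.card F ^ 3 + Fintype.card F ^ 4 := by
  have e : {a : Fin 8 → F // octN a = 0 ∧ a 7 = 0} ≃
      F × {p : (Fin 3 → F) × (Fin 3 → F) // p.1 ⬝ᵥ p.2 = 0} :=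
    { toFun := fun a => (a.1 0, ⟨(![a.1 1, a.1 2, a.1 3], ![a.1 6, a.1 5, a.1 4]), by
        have h := a.2.1
        simp only [octN, a.2.2] at h
        simp [dotProduct, Fin.sum_univ_three]
        linear_combination h⟩)
      invFun := fun p =>
        ⟨![p.1, p.2.1.1 0, p.2.1.1 1, p.2.1.1 2, p.2.1.2 2, p.2.1.2 1, p.2.1.2 0, 0], by
          have h := p.2.2
          simp only [dotProduct, Fin.sum_univ_three] at h
          simp [octN]
          linear_combination h⟩
      left_inv := fun a => by
        ext i
        fin_cases i <;> first | rfl | exact a.2.2.symm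
      right_inv := fun p => by
        ext i <;> first | rfl | (fin_cases i <;> rfl) }
  rw [Nat.card_congr e, Nat.card_prod, natCard_dotProduct_eq]
  simp only [Nat.card_eq_fintype_card, Nat.sub_mul, ← pow_add, one_mul, mul_add, Nat.mul_sub]
  simp [Fintype.card_subtype]
  ring_nf

/-- The number of pairs `(A, C) ∈ O × O` with `N(C) + 1 = 0`,
`N(A) = 0` and `Tr(x_1·Ā) = 0` equals `(q^7 − q^3)(q^6 − q^3 + q^4)`. -/
theorem stmt_10 {F : Type*} [Field F] [Fintype F] :
    Nat.card {p : (Fin 8 → F) × (Fin 8 → F) //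
        octN p.2 + 1 = 0 ∧ octN p.1 = 0 ∧ octTr (octMul octX1 (octConj p.1)) = 0} =
      (Fintype.card F ^ 7 - Fintype.card F ^ 3) *
        (Fintype.card F ^ 6 - Fintype.card F ^ 3 + Fintype.card F ^ 4) := by
  have htr (a : Fin 8 → F) : octTr (octMul octX1 (octConj a)) = a 7 := by
    simp [octTr, octMul, octX1, octConj]
  simp only [htr]
  rw [← natCard_octN_add_one_eq_zero, ← natCard_octN_eq_zero_and_eq_zero, mul_comm,
    ← Nat.card_prod]
  refine Nat.card_congr ((Equiv.subtypeEquivRight fun p => and_comm).trans ?_)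
  exact Equiv.subtypeProdEquivProd (p := fun a : Fin 8 → F => octN a = 0 ∧ a 7 = 0)
    (q := fun c : Fin 8 → F => octN c + 1 = 0)
end

section
/- Let i ≥ 1 be an integer and let M be a set of singular points of V with |M| = i(q^r − 1)/(q − 1). Then the following are equivalent: (1) |P^⊥ ∩ M| = q^{r−1} + i(q^{r−1} − 1)/(q − 1) for every point P ∈ M; (2) |P^⊥ ∩ M| = i(q^{r−1} − 1)/(q − 1) for every singular point P of V not in M; (3) both (1) and (2) hold, i.e., M is an i-tight set of the elliptic polar space Q^-(2r+1, q). -/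
variable {F V : Type*} [Field F] [AddCommGroup V] [Module F V]

/-- The polar form `B_Q(x, y) = Q(x + y) − Q(x) − Q(y)` of a quadratic form `Q`. -/
def polarB (Q : QuadraticForm F V) (u v : V) : F := Q (u + v) - Q u - Q v

/-- `P` is a singular point: a `1`-dimensional subspace spanned by a nonzero
vector `u` with `Q(u) = 0`. -/
def IsSingularPoint (Q : QuadraticForm F V) (P : Submodule F V) : Prop :=
  ∃ u : V, u ≠ 0 ∧ Q u = 0 ∧ P = Submodule.span F {u}

/-- `P^⊥ ∩ M`: the members of `M` all of whose vectors are orthogonal (with respect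
to the polar form of `Q`) to all vectors of `P`. -/
def perpIn (Q : QuadraticForm F V) (P : Submodule F V) (M : Set (Submodule F V)) :
    Set (Submodule F V) :=
  {R ∈ M | ∀ u ∈ P, ∀ v ∈ R, polarB Q u v = 0}

section EllipticCounting

open Finset QuadraticMap

/-- The orthogonal complement of `U` with respect to the polar form of `Q`. -/
abbrev perpSpace (Q : QuadraticForm F V) (U : Submodule F V) : Submodule F V :=
  LinearMap.BilinForm.orthogonal Q.polarBilin U

lemma mem_perpSpace {Q : QuadraticForm F V} {U : Submodule F V} {v : V} :
    v ∈ perpSpace Q U ↔ ∀ w ∈ U, polar Q w v = 0 := Iff.rfl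

/-- The fibres of a nonzero linear functional all have `|U| / |F|` elements. -/
lemma card_mul_card_functional_fiber {F U : Type*} [Field F] [Fintype F] [AddCommGroup U]
    [Module F U] [Fintype U] [DecidableEq F] (φ : U →ₗ[F] F) (hφ : φ ≠ 0) (c : F) :
    Fintype.card F * #{w | φ w = c} = Fintype.card U := by
  have hsurj : Function.Surjective φ := LinearMap.surjective hφ
  have hfib (d : F) : #{w | φ w = d} = #{w | φ w = c} := by
    obtain ⟨a, ha⟩ := hsurj (c - d)
    refine card_equiv (Equiv.addRight a) fun w => ?_
    simp only [mem_filter, mem_univ, true_and, Equiv.coe_addRight, map_add, ha]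
    constructor <;> intro h
    · rw [h]; ring
    · linear_combination h
  have h := card_eq_sum_card_fiberwise (f := φ) (s := univ) (t := univ)
    fun _ _ => mem_coe.2 (mem_univ _)
  simpa only [hfib, sum_const, card_univ, smul_eq_mul] using h.symm

open Classical in
/-- If `U` is a totally singular subspace of `X` containing every singular vector of `X ∩ U^⊥`,
the number of singular vectors of `X` is determined by the sizes of `X`, `U` and `X ∩ U^⊥`. -/
lemma card_mul_card_singular_add [Fintype F] [Fintype V] (Q : QuadraticForm F V)
    (X U : Submodule F V) (hUX : U ≤ X)
    (hU : ∀ w ∈ U, Q w = 0)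
    (hmax : ∀ v ∈ X, Q v = 0 → v ∈ perpSpace Q U → v ∈ U) :
    Fintype.card F * #{v | v ∈ X ∧ Q v = 0} + Nat.card ↥(X ⊓ perpSpace Q U) =
      Fintype.card F * Nat.card U + Nat.card X := by
  set Y := perpSpace Q U
  have hadd (v : V) (w : U) : Q (v + w) = Q v + polar Q w v := by
    have := hU w w.2
    rw [polar_comm, polar]; rw [this]; ring
  have hfib (v : V) (hv : v ∈ X) : Fintype.card F * #{w : U | Q (v + w) = 0} =
      (if v ∈ Y then 0 else Fintype.card U) +
      (if v ∈ U then Fintype.card F * Fintype.card U else 0) := by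
    by_cases hY : v ∈ Y
    · have hQ (w : U) : Q (v + w) = Q v := by
        have h0 : polar Q w v = 0 := hY w w.2
        rw [hadd, h0, add_zero]
      by_cases hvU : v ∈ U
      · simp [hY, hvU, hQ, hU v hvU]
      · have : Q v ≠ 0 := fun h => hvU (hmax v hv h hY)
        simp [hY, hvU, hQ, this]
    · have hvU : v ∉ U := fun h => hY fun w hw => by
        have h1 := hadd v ⟨w, hw⟩
        rw [hU _ (U.add_mem h hw), hU v h] at h1
        simpa using h1.symm
      let φ : U →ₗ[F] F := (Q.polarBilin v).comp U.subtype
      have hφ (w : U) : φ w = polar Q w v := polar_comm _ _ _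
      have hφ0 : φ ≠ 0 := fun h => hY fun w hw => by
        have := hφ ⟨w, hw⟩
        rw [h] at this
        exact this.symm
      have := card_mul_card_functional_fiber φ hφ0 (- Q v)
      simp only [hY, hvU, if_false, add_zero]
      rw [← this]
      congr 2
      ext w
      simp only [mem_filter, mem_univ, true_and, hadd, hφ]
      constructor <;> intro h <;> linear_combination h
  have hcount : ∑ v with v ∈ X, #{w : U | Q (v + w) = 0} =
      Fintype.card U * #{v | v ∈ X ∧ Q v = 0} := by
    have hswap := sum_card_bipartiteAbove_eq_sum_card_bipartiteBelow
      (s := ({v | v ∈ X} : Finset V)) (t := (univ : Finset U)) (fun v (w : U) => Q (v + w) = 0)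
    simp only [bipartiteAbove, bipartiteBelow] at hswap
    rw [hswap, sum_const_nat (m := #{v | v ∈ X ∧ Q v = 0}), card_univ]
    intro w _
    refine card_equiv (Equiv.addRight (w : V)) fun v => ?_
    simp [X.add_mem_iff_left (hUX w.2)]
  have hcards (Z : Submodule F V) : Nat.card Z = #{v | v ∈ Z} := by
    rw [Nat.card_eq_fintype_card, Fintype.card_subtype]
  have hmain := congrArg (Fintype.card F * ·) hcount
  simp only [mul_sum] at hmain
  rw [sum_congr rfl fun v hv => hfib v (by simpa using hv), sum_add_distrib] at hmain
  have h1 : ∑ v with v ∈ X, (if v ∈ Y then 0 else Fintype.card U) =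
      #{v | v ∈ X ∧ v ∉ Y} * Fintype.card U := by
    rw [← filter_filter, card_filter, sum_mul]
    exact sum_congr rfl fun v _ => by split_ifs <;> simp_all
  have h2 : ∑ v with v ∈ X, (if v ∈ U then Fintype.card F * Fintype.card U else 0) =
      Fintype.card U * (Fintype.card F * Fintype.card U) := by
    rw [← sum_filter, filter_filter, sum_const, smul_eq_mul, ← Nat.card_eq_fintype_card (α := U),
      hcards U]
    congr 3
    ext v
    exact and_iff_right_of_imp fun h => hUX h
  have h3 : Nat.card ↥(X ⊓ Y) + #{v | v ∈ X ∧ v ∉ Y} = Nat.card X := by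
    rw [hcards, hcards, ← card_filter_add_card_filter_not (s := ({v | v ∈ X} : Finset V))
      (p := (· ∈ Y))]
    simp [filter_filter]
  rw [h1, h2] at hmain
  have hpos : 0 < Fintype.card U := Fintype.card_pos
  rw [← h3, Nat.card_eq_fintype_card (α := U)]
  apply Nat.eq_of_mul_eq_mul_left hpos
  linarith

lemma natCard_submodule [Fintype F] [Fintype V] (U : Submodule F V) :
    Nat.card U = Fintype.card F ^ Module.finrank F U := by
  rw [Module.natCard_eq_pow_finrank (K := F), Nat.card_eq_fintype_card]

/-- `Q` is a form on a `(2r+2)`-dimensional space with nondegenerate polar form and Witt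
index `r`. -/
structure IsElliptic (Q : QuadraticForm F V) (r : ℕ) : Prop where
  finrank_eq : Module.finrank F V = 2 * r + 2
  nondegenerate : ∀ u : V, (∀ v : V, polar Q u v = 0) → u = 0
  exists_singular : ∃ W : Submodule F V, Module.finrank F W = r ∧ ∀ v ∈ W, Q v = 0
  not_exists_singular : ¬ ∃ W : Submodule F V, Module.finrank F W = r + 1 ∧ ∀ v ∈ W, Q v = 0

lemma mem_perpSpace_span_singleton {Q : QuadraticForm F V} {u v : V} :
    v ∈ perpSpace Q (F ∙ u) ↔ polar Q u v = 0 := by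
  rw [mem_perpSpace]
  refine ⟨fun h => h u (Submodule.mem_span_singleton_self u), fun h w hw => ?_⟩
  obtain ⟨a, rfl⟩ := Submodule.mem_span_singleton.1 hw
  rw [polar_smul_left, h, smul_zero]

lemma perpSpace_sup {Q : QuadraticForm F V} {U W : Submodule F V} :
    perpSpace Q (U ⊔ W) = perpSpace Q U ⊓ perpSpace Q W := by
  refine le_antisymm (le_inf (LinearMap.BilinForm.orthogonal_le le_sup_left)
    (LinearMap.BilinForm.orthogonal_le le_sup_right)) fun v hv => ?_
  rw [mem_perpSpace]
  intro w hw
  obtain ⟨a, ha, b, hb, rfl⟩ := Submodule.mem_sup.1 hw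
  rw [polar_add_left, mem_perpSpace.1 hv.1 a ha, mem_perpSpace.1 hv.2 b hb, add_zero]

lemma finrank_sup_span_singleton_of_notMem [FiniteDimensional F V] {U : Submodule F V} {v : V}
    (hv : v ∉ U) : Module.finrank F ↥(U ⊔ F ∙ v) = Module.finrank F U + 1 := by
  have hv0 : v ≠ 0 := fun h => hv (h ▸ U.zero_mem)
  have hdisj : U ⊓ F ∙ v = ⊥ := ((Submodule.disjoint_span_singleton' hv0).2 hv).eq_bot
  have := Submodule.finrank_sup_add_finrank_inf_eq U (F ∙ v)
  rwa [hdisj, finrank_bot, finrank_span_singleton hv0] at this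

lemma polar_eq_zero_of_singular {Q : QuadraticForm F V} {U : Submodule F V}
    (hU : ∀ v ∈ U, Q v = 0) {u v : V} (hu : u ∈ U) (hv : v ∈ U) : polar Q u v = 0 := by
  simp [polar, hU _ (U.add_mem hu hv), hU u hu, hU v hv]

lemma singular_sup_span_singleton {Q : QuadraticForm F V} {U : Submodule F V}
    (hU : ∀ v ∈ U, Q v = 0) {v : V} (hv : Q v = 0) (hp : v ∈ perpSpace Q U) :
    ∀ x ∈ U ⊔ F ∙ v, Q x = 0 := by
  intro x hx
  obtain ⟨a, ha, b, hb, rfl⟩ := Submodule.mem_sup.1 hx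
  obtain ⟨c, rfl⟩ := Submodule.mem_span_singleton.1 hb
  have h := QuadraticMap.map_add Q a (c • v)
  rwa [polar_smul_right, mem_perpSpace.1 hp a ha, hU a ha, QuadraticMap.map_smul, hv,
    smul_zero, smul_zero, add_zero, add_zero] at h

namespace IsElliptic

variable {Q : QuadraticForm F V} {r : ℕ}

lemma finrank_perpSpace (hQ : IsElliptic Q r) [FiniteDimensional F V] (U : Submodule F V) :
    Module.finrank F (perpSpace Q U) = 2 * r + 2 - Module.finrank F U := by
  rw [← hQ.finrank_eq]
  have hnd : Q.polarBilin.Nondegenerate := ⟨hQ.nondegenerate, fun v hv =>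
    hQ.nondegenerate v fun u => (polar_comm _ _ _).trans (hv u)⟩
  exact LinearMap.BilinForm.finrank_orthogonal hnd U

/-- A totally singular subspace of dimension `r` is maximal. -/
lemma mem_of_singular (hQ : IsElliptic Q r) [FiniteDimensional F V] {W : Submodule F V}
    (hr : Module.finrank F W = r) (hW : ∀ v ∈ W, Q v = 0) {v : V} (hv : Q v = 0)
    (hp : v ∈ perpSpace Q W) : v ∈ W := by
  by_contra h
  exact hQ.not_exists_singular ⟨W ⊔ F ∙ v, by rw [finrank_sup_span_singleton_of_notMem h, hr],
    singular_sup_span_singleton hW hv hp⟩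

/-- If `u` is singular and not in the maximal totally singular subspace `W`, then `u^⊥` cuts `W`
in a hyperplane. -/
lemma finrank_inf_perpSpace (hQ : IsElliptic Q r) [FiniteDimensional F V] {W : Submodule F V}
    (hr : Module.finrank F W = r) (hW : ∀ v ∈ W, Q v = 0) {u : V} (hu : Q u = 0)
    (huW : u ∉ W) : Module.finrank F ↥(W ⊓ perpSpace Q (F ∙ u)) + 1 = r := by
  let φ : W →ₗ[F] F := (Q.polarBilin u).comp W.subtype
  have hφ : φ ≠ 0 := fun h => huW <| hQ.mem_of_singular hr hW hu fun w hw =>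
    (polar_comm _ _ _).trans (LinearMap.congr_fun h ⟨w, hw⟩)
  have hker : (LinearMap.ker φ).map W.subtype = W ⊓ perpSpace Q (F ∙ u) := by
    ext x
    simp only [Submodule.mem_map, LinearMap.mem_ker, Submodule.mem_inf,
      mem_perpSpace_span_singleton]
    constructor
    · rintro ⟨y, hy, rfl⟩
      exact ⟨y.2, hy⟩
    · rintro ⟨hx, hx'⟩
      exact ⟨⟨x, hx⟩, hx', rfl⟩
  have h := LinearMap.finrank_range_add_finrank_ker φ
  rw [LinearMap.range_eq_top.2 (LinearMap.surjective hφ), finrank_top, Module.finrank_self,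
    hr] at h
  rw [← hker, Submodule.finrank_map_subtype_eq]
  omega

/-- Any singular vector `u` lies in a maximal totally singular subspace containing the part of a
given one that is orthogonal to `u`. -/
lemma exists_singular_mem (hQ : IsElliptic Q r) [FiniteDimensional F V] {W : Submodule F V}
    (hr : Module.finrank F W = r) (hW : ∀ v ∈ W, Q v = 0) {u : V} (hu : Q u = 0) :
    ∃ W' : Submodule F V, Module.finrank F W' = r ∧ (∀ v ∈ W', Q v = 0) ∧ u ∈ W' ∧
      W ⊓ perpSpace Q (F ∙ u) ≤ W' := by
  by_cases huW : u ∈ W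
  · exact ⟨W, hr, hW, huW, inf_le_left⟩
  refine ⟨(W ⊓ perpSpace Q (F ∙ u)) ⊔ F ∙ u, ?_, ?_, ?_, le_sup_left⟩
  · rw [finrank_sup_span_singleton_of_notMem fun h => huW (Submodule.mem_inf.1 h).1,
      hQ.finrank_inf_perpSpace hr hW hu huW]
  · refine singular_sup_span_singleton (fun v hv => hW v (Submodule.mem_inf.1 hv).1) hu fun w hw => ?_
    exact (polar_comm _ _ _).trans (mem_perpSpace_span_singleton.1 hw.2)
  · exact Submodule.mem_sup_right (Submodule.mem_span_singleton_self u)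

lemma le_perpSpace {U W : Submodule F V} (hW : ∀ v ∈ W, Q v = 0) (h : U ≤ W) :
    W ≤ perpSpace Q U :=
  fun _ hv _ hw => polar_eq_zero_of_singular hW (h hw) hv

open Classical in
/-- The number of singular vectors of the orthogonal complement of a totally singular space of
dimension `d` that is contained in a maximal totally singular space. -/
lemma card_singular_perpSpace [Fintype F] [Fintype V] (hQ : IsElliptic Q r) {U W : Submodule F V}
    (hr : Module.finrank F W = r) (hW : ∀ v ∈ W, Q v = 0) (hUW : U ≤ W) :
    Fintype.card F * #{v | v ∈ perpSpace Q U ∧ Q v = 0} + Fintype.card F ^ (r + 2) =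
      Fintype.card F * Fintype.card F ^ r +
        Fintype.card F ^ (2 * r + 2 - Module.finrank F U) := by
  have h := card_mul_card_singular_add Q (perpSpace Q U) W (le_perpSpace hW hUW) hW
    fun v _ hv hp => hQ.mem_of_singular hr hW hv hp
  rw [inf_eq_right.2 (LinearMap.BilinForm.orthogonal_le hUW)] at h
  simp only [natCard_submodule, hQ.finrank_perpSpace, hr] at h
  rwa [show 2 * r + 2 - r = r + 2 by omega] at h

open Classical in
lemma card_singular [Fintype F] [Fintype V] (hQ : IsElliptic Q r) :
    Fintype.card F * #{v : V | Q v = 0} + Fintype.card F ^ (r + 2) =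
      Fintype.card F * Fintype.card F ^ r + Fintype.card F ^ (2 * r + 2) := by
  obtain ⟨W, hr, hW⟩ := hQ.exists_singular
  have h := hQ.card_singular_perpSpace hr hW (bot_le (a := W))
  rw [finrank_bot] at h
  simpa [mem_perpSpace] using h

open Classical in
/-- The number of singular vectors orthogonal to a nonzero singular vector. -/
lemma card_singular_orthogonal [Fintype F] [Fintype V] (hQ : IsElliptic Q r) {u : V}
    (hu0 : u ≠ 0) (hu : Q u = 0) :
    Fintype.card F * #{v | polar Q u v = 0 ∧ Q v = 0} + Fintype.card F ^ (r + 2) =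
      Fintype.card F * Fintype.card F ^ r + Fintype.card F ^ (2 * r + 1) := by
  obtain ⟨W₀, hr₀, hW₀⟩ := hQ.exists_singular
  obtain ⟨W, hr, hW, huW, -⟩ := hQ.exists_singular_mem hr₀ hW₀ hu
  have h := hQ.card_singular_perpSpace hr hW ((Submodule.span_singleton_le_iff_mem u W).2 huW)
  simpa only [finrank_span_singleton hu0, mem_perpSpace_span_singleton,
    show 2 * r + 2 - 1 = 2 * r + 1 by omega] using h

open Classical in
/-- The number of singular vectors orthogonal to two orthogonal independent singular vectors. -/
lemma card_singular_orthogonal_pair [Fintype F] [Fintype V] (hQ : IsElliptic Q r) {u w : V}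
    (hu0 : u ≠ 0) (hu : Q u = 0) (hw : Q w = 0) (huw : polar Q u w = 0) (hw' : w ∉ F ∙ u) :
    Fintype.card F * #{v | (polar Q u v = 0 ∧ polar Q w v = 0) ∧ Q v = 0} +
        Fintype.card F ^ (r + 2) =
      Fintype.card F * Fintype.card F ^ r + Fintype.card F ^ (2 * r) := by
  obtain ⟨W₀, hr₀, hW₀⟩ := hQ.exists_singular
  obtain ⟨W₁, hr₁, hW₁, huW₁, -⟩ := hQ.exists_singular_mem hr₀ hW₀ hu
  obtain ⟨W, hr, hW, hwW, hle⟩ := hQ.exists_singular_mem hr₁ hW₁ hw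
  have huW : u ∈ W :=
    hle ⟨huW₁, mem_perpSpace_span_singleton.2 ((polar_comm _ _ _).trans huw)⟩
  have h := hQ.card_singular_perpSpace hr hW (U := F ∙ u ⊔ F ∙ w) (by
    simp [huW, hwW])
  simpa only [finrank_sup_span_singleton_of_notMem hw', finrank_span_singleton hu0,
    perpSpace_sup, Submodule.mem_inf, mem_perpSpace_span_singleton,
    show 2 * r + 2 - (1 + 1) = 2 * r by omega] using h

open Classical in
/-- The number of singular vectors orthogonal to two non-orthogonal singular vectors. -/
lemma card_singular_hyperbolic_pair [Fintype F] [Fintype V] (hQ : IsElliptic Q r) {u w : V}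
    (hu : Q u = 0) (hw : Q w = 0) (huw : polar Q u w ≠ 0) :
    Fintype.card F * #{v | (polar Q u v = 0 ∧ polar Q w v = 0) ∧ Q v = 0} +
        Fintype.card F ^ (r + 1) =
      Fintype.card F * Fintype.card F ^ (r - 1) + Fintype.card F ^ (2 * r) := by
  have hu0 : u ≠ 0 := by rintro rfl; simp at huw
  obtain ⟨W₀, hr₀, hW₀⟩ := hQ.exists_singular
  obtain ⟨W, hr, hW, huW, -⟩ := hQ.exists_singular_mem hr₀ hW₀ hu
  have hwW : w ∉ W := fun h => huw (polar_eq_zero_of_singular hW huW h)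
  have hwu : w ∉ F ∙ u := fun h => hwW ((Submodule.span_singleton_le_iff_mem u W).2 huW h)
  have hUr := hQ.finrank_inf_perpSpace hr hW hw hwW
  set U := W ⊓ perpSpace Q (F ∙ w) with hUdef
  have hperp : perpSpace Q (F ∙ u ⊔ F ∙ w) ⊓ perpSpace Q U = perpSpace Q (W ⊔ F ∙ w) := by
    rw [perpSpace_sup, perpSpace_sup]
    refine le_antisymm (fun v hv => ⟨fun x hx => ?_, hv.1.2⟩)
      (le_inf (inf_le_inf_right _ <| LinearMap.BilinForm.orthogonal_le <|
        (Submodule.span_singleton_le_iff_mem u W).2 huW)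
        (inf_le_left.trans <| LinearMap.BilinForm.orthogonal_le inf_le_left))
    have huv := mem_perpSpace_span_singleton.1 hv.1.1
    set c := polar Q x w / polar Q u w
    have hxU : x - c • u ∈ U := by
      refine ⟨W.sub_mem hx (W.smul_mem c huW), mem_perpSpace_span_singleton.2 ?_⟩
      rw [polar_comm, polar_sub_left, polar_smul_left, smul_eq_mul, div_mul_cancel₀ _ huw, sub_self]
    have h : polar Q (x - c • u) v = 0 := hv.2 _ hxU
    rw [polar_sub_left, polar_smul_left, huv, smul_zero, sub_zero] at h
    exact h
  have hU : U ≤ perpSpace Q (F ∙ u ⊔ F ∙ w) := by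
    rw [perpSpace_sup]
    refine le_inf (fun v hv => ?_) inf_le_right
    exact mem_perpSpace_span_singleton.2 (polar_eq_zero_of_singular hW huW hv.1)
  have h := card_mul_card_singular_add Q _ U hU (fun v hv => hW v hv.1) fun v hv hv0 hp => by
    have hv' : v ∈ perpSpace Q (W ⊔ F ∙ w) := hperp ▸ ⟨hv, hp⟩
    rw [perpSpace_sup] at hv'
    exact ⟨hQ.mem_of_singular hr hW hv0 hv'.1, hv'.2⟩
  rw [hperp, natCard_submodule, natCard_submodule, natCard_submodule, hQ.finrank_perpSpace,
    hQ.finrank_perpSpace, finrank_sup_span_singleton_of_notMem hwW,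
    finrank_sup_span_singleton_of_notMem hwu, finrank_span_singleton hu0, hr,
    show 2 * r + 2 - (r + 1) = r + 1 by omega, show 2 * r + 2 - (1 + 1) = 2 * r by omega,
    show Module.finrank F U = r - 1 by omega] at h
  simpa only [perpSpace_sup, Submodule.mem_inf, mem_perpSpace_span_singleton] using h

end IsElliptic

section TightSets

lemma sub_one_mul_div_sub_one {q : ℕ} (hq : 1 < q) (i n : ℕ) :
    ((q : ℤ) - 1) * (i * (q ^ n - 1) / (q - 1) : ℕ) = i * ((q : ℤ) ^ n - 1) := by
  have hdvd : q - 1 ∣ i * (q ^ n - 1) := by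
    simpa using (Nat.sub_dvd_pow_sub_pow q 1 n).mul_left i
  have h := congrArg (Nat.cast (R := ℤ)) (Nat.mul_div_cancel' hdvd)
  rwa [Nat.cast_mul, Nat.cast_mul, Nat.cast_sub hq.le,
    Nat.cast_sub (Nat.one_le_pow _ _ (by omega)), Nat.cast_pow, Nat.cast_one] at h

variable [Fintype V]

open Classical in
/-- A line of `V` contains `|F| - 1` nonzero vectors. -/
lemma card_nonzero_span_singleton [Fintype F] {u : V} (hu : u ≠ 0) :
    #{v | v ≠ 0 ∧ v ∈ F ∙ u} = Fintype.card F - 1 := by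
  have h : Nat.card (F ∙ u) = Fintype.card F := by
    rw [natCard_submodule, finrank_span_singleton hu, pow_one]
  rw [Nat.card_eq_fintype_card, Fintype.card_subtype] at h
  rw [← h, ← card_erase_of_mem (a := (0 : V)) (by simp)]
  congr 1
  ext v
  simp

/-- A nonzero vector of a line spans it. -/
lemma span_singleton_eq_of_mem {K E : Type*} [Field K] [AddCommGroup E] [Module K E] {u v : E}
    (hv : v ≠ 0) (h : v ∈ K ∙ u) : K ∙ v = K ∙ u := by
  obtain ⟨c, rfl⟩ := Submodule.mem_span_singleton.1 h
  have hc : c ≠ 0 := by rintro rfl; simp at hv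
  exact Submodule.span_singleton_smul_eq hc.isUnit u

open Classical in
/-- The nonzero vectors spanning a member of `T`. -/
noncomputable def nonzeroVectors (T : Set (Submodule F V)) : Finset V := {v | v ≠ 0 ∧ F ∙ v ∈ T}

lemma mem_nonzeroVectors {T : Set (Submodule F V)} {v : V} :
    v ∈ nonzeroVectors T ↔ v ≠ 0 ∧ F ∙ v ∈ T := by
  simp [nonzeroVectors]

open Classical in
/-- The number of nonzero vectors on the lines of a set of lines. -/
lemma card_mul_ncard_lines [Fintype F] (T : Set (Submodule F V))
    (hT : ∀ P ∈ T, ∃ u : V, u ≠ 0 ∧ P = F ∙ u) :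
    (Fintype.card F - 1) * T.ncard = #(nonzeroVectors T) := by
  have : Finite (Submodule F V) := Finite.of_injective _ SetLike.coe_injective
  have := Fintype.ofFinite (Submodule F V)
  rw [Set.ncard_eq_toFinset_card', card_eq_sum_card_fiberwise (f := fun v : V => F ∙ v)
    (t := T.toFinset) (fun v hv => by simpa using (mem_nonzeroVectors.1 hv).2),
    sum_const_nat (m := Fintype.card F - 1), mul_comm]
  intro P hP
  rw [Set.mem_toFinset] at hP
  obtain ⟨u, hu, rfl⟩ := hT P hP
  rw [← card_nonzero_span_singleton hu]
  congr 1
  ext v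
  simp only [mem_filter, mem_univ, true_and, mem_nonzeroVectors]
  constructor
  · rintro ⟨⟨hv, -⟩, h⟩
    exact ⟨hv, h ▸ Submodule.mem_span_singleton_self v⟩
  · rintro ⟨hv, h⟩
    have := span_singleton_eq_of_mem hv h
    exact ⟨⟨hv, this ▸ hP⟩, this⟩

open Classical in
lemma nonzeroVectors_perpIn (Q : QuadraticForm F V) (u : V) (M : Set (Submodule F V)) :
    nonzeroVectors (perpIn Q (F ∙ u) M) = {v ∈ nonzeroVectors M | polar Q u v = 0} := by
  ext v
  simp only [mem_nonzeroVectors, mem_filter, perpIn, Set.mem_ofPred_eq, and_assoc]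
  refine and_congr_right fun _ => and_congr_right fun _ => ⟨fun h =>
    h u (Submodule.mem_span_singleton_self u) v (Submodule.mem_span_singleton_self v), ?_⟩
  intro h x hx y hy
  obtain ⟨a, rfl⟩ := Submodule.mem_span_singleton.1 hx
  obtain ⟨b, rfl⟩ := Submodule.mem_span_singleton.1 hy
  change polar Q (a • u) (b • v) = 0
  rw [polar_smul_left, polar_smul_right, h, smul_zero, smul_zero]

variable {Q : QuadraticForm F V} {r : ℕ}

open Classical in
/-- The finset of nonzero singular vectors. -/
noncomputable def singularVectors (Q : QuadraticForm F V) : Finset V := {v | v ≠ 0 ∧ Q v = 0}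

lemma mem_singularVectors {v : V} : v ∈ singularVectors Q ↔ v ≠ 0 ∧ Q v = 0 := by
  simp [singularVectors]

open Classical in
lemma card_filter_singularVectors (p : V → Prop) [DecidablePred p] (hp : p 0) :
    #{v ∈ singularVectors Q | p v} + 1 = #{v | p v ∧ Q v = 0} := by
  rw [← card_erase_add_one (s := ({v | p v ∧ Q v = 0} : Finset V)) (a := 0) (by simp [hp])]
  congr 2
  ext v
  simp only [mem_filter, mem_singularVectors, mem_erase, mem_univ, true_and]
  tauto

namespace IsElliptic

variable [Fintype F]

lemma card_singularVectors (hQ : IsElliptic Q (r + 1)) :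
    (#(singularVectors Q) : ℤ) = ((Fintype.card F : ℤ) ^ r * Fintype.card F - 1) *
      ((Fintype.card F : ℤ) ^ r * Fintype.card F ^ 2 + 1) := by
  classical
  have h := hQ.card_singular
  have h1 := card_filter_singularVectors (Q := Q) (fun _ => True) trivial
  simp only [filter_true, true_and] at h1
  rw [← h1] at h
  have hq : (Fintype.card F : ℤ) ≠ 0 := by exact_mod_cast Fintype.card_ne_zero
  zify at h
  apply mul_left_cancel₀ hq
  linear_combination h

open Classical in
lemma card_singularVectors_orthogonal (hQ : IsElliptic Q (r + 1)) {u : V}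
    (hu : u ∈ singularVectors Q) :
    (#{x ∈ singularVectors Q | polar Q u x = 0} : ℤ) =
      (Fintype.card F : ℤ) ^ r * Fintype.card F + (Fintype.card F ^ r) ^ 2 * Fintype.card F ^ 2
        - Fintype.card F ^ r * Fintype.card F ^ 2 - 1 := by
  rw [mem_singularVectors] at hu
  have h := hQ.card_singular_orthogonal hu.1 hu.2
  rw [← card_filter_singularVectors (polar Q u · = 0) (polar_zero_right Q u)] at h
  have hq : (Fintype.card F : ℤ) ≠ 0 := by exact_mod_cast Fintype.card_ne_zero
  zify at h
  apply mul_left_cancel₀ hq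
  linear_combination h

open Classical in
/-- The number of singular vectors orthogonal to two given ones: the collinearity graph of the
elliptic quadric is strongly regular. -/
lemma card_singularVectors_orthogonal_pair (hQ : IsElliptic Q (r + 1)) {u w : V}
    (hu : u ∈ singularVectors Q) (hw : w ∈ singularVectors Q) :
    (#{x ∈ singularVectors Q | polar Q u x = 0 ∧ polar Q w x = 0} : ℤ) =
      ((Fintype.card F : ℤ) ^ r + (Fintype.card F ^ r) ^ 2 * Fintype.card F
        - Fintype.card F ^ r * Fintype.card F - 1)
      - (if polar Q u w = 0 then
          (Fintype.card F : ℤ) ^ r * (Fintype.card F - 1) ^ 2 else 0)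
      + (if w ∈ F ∙ u then
          ((Fintype.card F : ℤ) ^ r) ^ 2 * Fintype.card F * (Fintype.card F - 1) else 0) := by
  have hq : (Fintype.card F : ℤ) ≠ 0 := by exact_mod_cast Fintype.card_ne_zero
  have hK := hQ.card_singularVectors_orthogonal hu
  rw [mem_singularVectors] at hu hw
  by_cases hwu : w ∈ F ∙ u
  · obtain ⟨c, rfl⟩ := Submodule.mem_span_singleton.1 hwu
    have hpol : polar Q u (c • u) = 0 := by
      rw [polar_smul_right, polar_self, hu.2, smul_zero, smul_zero]
    have hiff (x : V) : (polar Q u x = 0 ∧ polar Q (c • u) x = 0) ↔ polar Q u x = 0 :=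
      and_iff_left_of_imp fun h => by rw [polar_smul_left, h, smul_zero]
    simp only [hiff, hpol, hwu, if_true]
    rw [hK]
    ring
  · by_cases huw : polar Q u w = 0
    · have h := hQ.card_singular_orthogonal_pair hu.1 hu.2 hw.2 huw hwu
      rw [← card_filter_singularVectors (fun v => polar Q u v = 0 ∧ polar Q w v = 0)
        ⟨polar_zero_right Q u, polar_zero_right Q w⟩] at h
      simp only [huw, hwu, if_true, if_false]
      zify at h
      apply mul_left_cancel₀ hq
      linear_combination h
    · have h := hQ.card_singular_hyperbolic_pair hu.2 hw.2 huw
      rw [← card_filter_singularVectors (fun v => polar Q u v = 0 ∧ polar Q w v = 0)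
        ⟨polar_zero_right Q u, polar_zero_right Q w⟩] at h
      simp only [huw, hwu, if_false]
      rw [Nat.add_sub_cancel] at h
      zify at h
      apply mul_left_cancel₀ hq
      linear_combination h

open Classical in
lemma sum_card_orthogonal (hQ : IsElliptic Q (r + 1)) {D : Finset V}
    (hD : D ⊆ singularVectors Q) :
    ∑ x ∈ singularVectors Q, (#{v ∈ D | polar Q x v = 0} : ℤ) =
      #D * ((Fintype.card F : ℤ) ^ r * Fintype.card F
        + (Fintype.card F ^ r) ^ 2 * Fintype.card F ^ 2
        - Fintype.card F ^ r * Fintype.card F ^ 2 - 1) := by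
  have h := sum_card_bipartiteAbove_eq_sum_card_bipartiteBelow (s := singularVectors Q) (t := D)
    (fun x v => polar Q x v = 0)
  simp only [bipartiteAbove, bipartiteBelow] at h
  zify at h
  rw [h, ← nsmul_eq_mul, ← sum_const]
  refine sum_congr rfl fun v hv => ?_
  rw [← hQ.card_singularVectors_orthogonal (hD hv)]
  simp only [polar_comm Q v]

open Classical in
lemma sum_sq_card_orthogonal (hQ : IsElliptic Q (r + 1)) {D : Finset V}
    (hD : D ⊆ singularVectors Q) (hsmul : ∀ v ∈ D, ∀ w ≠ 0, w ∈ F ∙ v → w ∈ D) :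
    ∑ x ∈ singularVectors Q, (#{v ∈ D | polar Q x v = 0} : ℤ) ^ 2 =
      #D ^ 2 * ((Fintype.card F : ℤ) ^ r + (Fintype.card F ^ r) ^ 2 * Fintype.card F
        - Fintype.card F ^ r * Fintype.card F - 1)
      - (Fintype.card F : ℤ) ^ r * (Fintype.card F - 1) ^ 2 *
          ∑ x ∈ D, (#{v ∈ D | polar Q x v = 0} : ℤ)
      + #D * (((Fintype.card F : ℤ) ^ r) ^ 2 * Fintype.card F * (Fintype.card F - 1) ^ 2) := by
  have hexp : ∑ x ∈ singularVectors Q, (#{v ∈ D | polar Q x v = 0} : ℤ) ^ 2 =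
      ∑ v ∈ D, ∑ w ∈ D,
        (#{x ∈ singularVectors Q | polar Q v x = 0 ∧ polar Q w x = 0} : ℤ) := by
    simp only [_root_.sq, natCast_card_filter, sum_mul_sum]
    rw [sum_comm]
    refine sum_congr rfl fun v _ => ?_
    rw [sum_comm]
    refine sum_congr rfl fun w _ => sum_congr rfl fun x _ => ?_
    rw [polar_comm Q x v, polar_comm Q x w, ite_and]
    split_ifs <;> simp
  have hline (v : V) (hv : v ∈ D) : (#{w ∈ D | w ∈ F ∙ v} : ℤ) = Fintype.card F - 1 := by
    have hv0 := (mem_singularVectors.1 (hD hv)).1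
    rw [← Nat.cast_pred Fintype.card_pos, ← card_nonzero_span_singleton (F := F) hv0]
    congr 2
    ext w
    simp only [mem_filter, mem_univ, true_and]
    exact ⟨fun h => ⟨(mem_singularVectors.1 (hD h.1)).1, h.2⟩,
      fun h => ⟨hsmul v hv w h.1 h.2, h.2⟩⟩
  have hinner (v : V) (hv : v ∈ D) :
      ∑ w ∈ D, (#{x ∈ singularVectors Q | polar Q v x = 0 ∧ polar Q w x = 0} : ℤ) =
      #D * ((Fintype.card F : ℤ) ^ r + (Fintype.card F ^ r) ^ 2 * Fintype.card F
        - Fintype.card F ^ r * Fintype.card F - 1)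
      - (Fintype.card F : ℤ) ^ r * (Fintype.card F - 1) ^ 2 * #{w ∈ D | polar Q v w = 0}
      + ((Fintype.card F : ℤ) ^ r) ^ 2 * Fintype.card F * (Fintype.card F - 1) ^ 2 := by
    rw [sum_congr rfl fun w hw => hQ.card_singularVectors_orthogonal_pair (hD hv) (hD hw)]
    rw [sum_add_distrib, sum_sub_distrib, sum_const, ← sum_filter, ← sum_filter, sum_const,
      sum_const]
    simp only [nsmul_eq_mul]
    rw [hline v hv]
    ring
  rw [hexp, sum_congr rfl hinner, sum_add_distrib, sum_sub_distrib, sum_const, sum_const,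
    ← mul_sum]
  simp only [nsmul_eq_mul]
  ring

open Classical in
/-- The deviation of `D` from being tight, measured by a sum of squares over all singular vectors,
is proportional to its mean deviation over `D`. -/
lemma sum_sq_deviation (hQ : IsElliptic Q (r + 1)) {D : Finset V}
    (hD : D ⊆ singularVectors Q) (hsmul : ∀ v ∈ D, ∀ w ≠ 0, w ∈ F ∙ v → w ∈ D) {i : ℤ}
    (hcard : (#D : ℤ) = i * ((Fintype.card F : ℤ) ^ r * Fintype.card F - 1)) :
    ∑ x ∈ singularVectors Q, ((#{v ∈ D | polar Q x v = 0} : ℤ)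
        - (if x ∈ D then ((Fintype.card F : ℤ) - 1) * Fintype.card F ^ r else 0)
        - i * ((Fintype.card F : ℤ) ^ r - 1)) ^ 2 =
      -((Fintype.card F : ℤ) ^ r * (Fintype.card F - 1) * (Fintype.card F + 1)) *
        ∑ x ∈ D, ((#{v ∈ D | polar Q x v = 0} : ℤ)
          - ((Fintype.card F : ℤ) - 1) * Fintype.card F ^ r
          - i * ((Fintype.card F : ℤ) ^ r - 1)) := by
  set e : ℤ := ((Fintype.card F : ℤ) - 1) * Fintype.card F ^ r with he
  set k : ℤ := i * ((Fintype.card F : ℤ) ^ r - 1) with hk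
  have hexp (x : V) : ((#{v ∈ D | polar Q x v = 0} : ℤ) - (if x ∈ D then e else 0) - k) ^ 2 =
      (#{v ∈ D | polar Q x v = 0} : ℤ) ^ 2 - 2 * k * (#{v ∈ D | polar Q x v = 0} : ℤ) + k ^ 2
      + (if x ∈ D then e ^ 2 + 2 * e * k - 2 * e * (#{v ∈ D | polar Q x v = 0} : ℤ) else 0) := by
    split_ifs <;> ring
  simp only [hexp]
  rw [sum_add_distrib, sum_add_distrib, sum_sub_distrib, ← mul_sum, sum_const, ← sum_filter,
    filter_mem_eq_inter, inter_eq_right.2 hD, sum_sub_distrib, ← mul_sum, sum_const,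
    hQ.sum_sq_card_orthogonal hD hsmul, hQ.sum_card_orthogonal hD, sum_sub_distrib,
    sum_sub_distrib, sum_const, sum_const]
  simp only [nsmul_eq_mul]
  rw [hQ.card_singularVectors, hcard, he, hk]
  ring

open Classical in
lemma sum_deviation (hQ : IsElliptic Q (r + 1)) {D : Finset V}
    (hD : D ⊆ singularVectors Q) {i : ℤ}
    (hcard : (#D : ℤ) = i * ((Fintype.card F : ℤ) ^ r * Fintype.card F - 1)) :
    ∑ x ∈ singularVectors Q, ((#{v ∈ D | polar Q x v = 0} : ℤ)
        - (if x ∈ D then ((Fintype.card F : ℤ) - 1) * Fintype.card F ^ r else 0)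
        - i * ((Fintype.card F : ℤ) ^ r - 1)) = 0 := by
  rw [sum_sub_distrib, sum_sub_distrib, ← sum_filter, filter_mem_eq_inter, inter_eq_right.2 hD,
    hQ.sum_card_orthogonal hD, sum_const, sum_const]
  simp only [nsmul_eq_mul]
  rw [hQ.card_singularVectors, hcard]
  ring

open Classical in
/-- For a union `D` of singular points of the size of an `i`-tight set, the intersection numbers at
the vectors of `D` are those of an `i`-tight set if and only if those at the vectors outside `D`
are. -/
lemma tight_inside_iff_tight_outside (hQ : IsElliptic Q (r + 1)) {D : Finset V}
    (hD : D ⊆ singularVectors Q) (hsmul : ∀ v ∈ D, ∀ w ≠ 0, w ∈ F ∙ v → w ∈ D) {i : ℤ}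
    (hcard : (#D : ℤ) = i * ((Fintype.card F : ℤ) ^ r * Fintype.card F - 1)) :
    (∀ x ∈ D, (#{v ∈ D | polar Q x v = 0} : ℤ) =
        ((Fintype.card F : ℤ) - 1) * Fintype.card F ^ r + i * ((Fintype.card F : ℤ) ^ r - 1)) ↔
      ∀ x ∈ singularVectors Q, x ∉ D →
        (#{v ∈ D | polar Q x v = 0} : ℤ) = i * ((Fintype.card F : ℤ) ^ r - 1) := by
  set h : V → ℤ := fun x => (#{v ∈ D | polar Q x v = 0} : ℤ)
    - (if x ∈ D then ((Fintype.card F : ℤ) - 1) * Fintype.card F ^ r else 0)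
    - i * ((Fintype.card F : ℤ) ^ r - 1) with hdef
  have hsq := hQ.sum_sq_deviation hD hsmul hcard
  have hsum := hQ.sum_deviation hD hcard
  have hin {x : V} (hx : x ∈ D) : h x = (#{v ∈ D | polar Q x v = 0} : ℤ)
      - ((Fintype.card F : ℤ) - 1) * Fintype.card F ^ r
      - i * ((Fintype.card F : ℤ) ^ r - 1) := by simp [hdef, hx]
  have hout {x : V} (hx : x ∉ D) : h x = (#{v ∈ D | polar Q x v = 0} : ℤ)
      - i * ((Fintype.card F : ℤ) ^ r - 1) := by simp [hdef, hx]
  rw [← sum_congr rfl fun x hx => hin hx] at hsq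
  have hzero (h0 : ∑ x ∈ D, h x = 0) : ∀ x ∈ singularVectors Q, h x = 0 := by
    rw [h0, mul_zero, sum_eq_zero_iff_of_nonneg fun _ _ => sq_nonneg _] at hsq
    exact fun x hx => pow_eq_zero_iff two_ne_zero |>.1 (hsq x hx)
  constructor
  · intro h1 x hx hxD
    have := hzero (sum_eq_zero fun y hy => by rw [hin hy, h1 y hy]; ring) x hx
    rw [hout hxD] at this
    linarith
  · intro h2 x hx
    have h0 : ∑ x ∈ D, h x = 0 := by
      rw [← hsum]
      refine sum_subset hD fun y hy hyD => ?_
      rw [hout hyD, h2 y hy hyD, sub_self]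
    have := hzero h0 x (hD hx)
    rw [hin hx] at this
    linarith

end IsElliptic

end TightSets

end EllipticCounting

/-- Let `F` be a finite field of order `q`, `r ≥ 2`, and `V` a
`(2r+2)`-dimensional `F`-space with a quadratic form `Q` whose polar form is
nondegenerate and whose Witt index is `r` (so the associated polar space is the
elliptic quadric `Q⁻(2r+1, q)`).  Let `i ≥ 1` and let `M` be a set of singular
points with `|M| = i(q^r − 1)/(q − 1)`.  The following are equivalent:
(1) `|P^⊥ ∩ M| = q^{r−1} + i(q^{r−1} − 1)/(q − 1)` for all `P ∈ M`;
(2) `|P^⊥ ∩ M| = i(q^{r−1} − 1)/(q − 1)` for all singular points `P ∉ M`;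
(3) both (1) and (2), i.e. `M` is an `i`-tight set. -/
theorem stmt_13 {F V : Type*} [Field F] [Fintype F] [AddCommGroup V] [Module F V]
    (Q : QuadraticForm F V) (r : ℕ) (hr : 2 ≤ r)
    (hdim : Module.finrank F V = 2 * r + 2)
    (hnd : ∀ u : V, (∀ v : V, polarB Q u v = 0) → u = 0)
    (hwitt : ∃ W : Submodule F V, Module.finrank F ↥W = r ∧ ∀ v ∈ W, Q v = 0)
    (hwitt' : ¬ ∃ W : Submodule F V, Module.finrank F ↥W = r + 1 ∧ ∀ v ∈ W, Q v = 0)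
    (i : ℕ) (hi : 1 ≤ i) (M : Set (Submodule F V))
    (hM : ∀ P ∈ M, IsSingularPoint Q P)
    (hcard : M.ncard = i * (Fintype.card F ^ r - 1) / (Fintype.card F - 1)) :
    List.TFAE [
      ∀ P ∈ M, (perpIn Q P M).ncard =
        Fintype.card F ^ (r - 1) +
          i * (Fintype.card F ^ (r - 1) - 1) / (Fintype.card F - 1),
      ∀ P : Submodule F V, IsSingularPoint Q P → P ∉ M → (perpIn Q P M).ncard =
        i * (Fintype.card F ^ (r - 1) - 1) / (Fintype.card F - 1),
      (∀ P ∈ M, (perpIn Q P M).ncard =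
        Fintype.card F ^ (r - 1) +
          i * (Fintype.card F ^ (r - 1) - 1) / (Fintype.card F - 1)) ∧
      ∀ P : Submodule F V, IsSingularPoint Q P → P ∉ M → (perpIn Q P M).ncard =
        i * (Fintype.card F ^ (r - 1) - 1) / (Fintype.card F - 1)] := by
  have hfinV : Module.Finite F V := Module.finite_of_finrank_pos (by omega)
  have : Finite V := Module.finite_of_finite F
  have := Fintype.ofFinite V
  classical
  obtain ⟨s, rfl⟩ : ∃ s, r = s + 1 := ⟨r - 1, by omega⟩
  have hQ : IsElliptic Q (s + 1) := ⟨hdim, hnd, hwitt, hwitt'⟩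
  rw [Nat.add_sub_cancel]
  set D := nonzeroVectors M with hDdef
  have hD : D ⊆ singularVectors Q := fun v hv => by
    obtain ⟨hv0, hvM⟩ := mem_nonzeroVectors.1 hv
    obtain ⟨u, -, hu, huv⟩ := hM _ hvM
    obtain ⟨c, rfl⟩ := Submodule.mem_span_singleton.1
      (huv ▸ Submodule.mem_span_singleton_self (R := F) v)
    exact mem_singularVectors.2 ⟨hv0, by rw [QuadraticMap.map_smul, hu, smul_zero]⟩
  have hsmul : ∀ v ∈ D, ∀ w ≠ 0, w ∈ F ∙ v → w ∈ D := fun v hv w hw hwv =>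
    mem_nonzeroVectors.2 ⟨hw, span_singleton_eq_of_mem hw hwv ▸ (mem_nonzeroVectors.1 hv).2⟩
  have hlines : ∀ P ∈ M, ∃ u : V, u ≠ 0 ∧ P = F ∙ u := fun P hP =>
    let ⟨u, hu, _, h⟩ := hM P hP
    ⟨u, hu, h⟩
  have hq : 1 < Fintype.card F := Fintype.one_lt_card
  have hq1 : (Fintype.card F : ℤ) - 1 ≠ 0 := by
    have : (1 : ℤ) < Fintype.card F := by exact_mod_cast hq
    omega
  have hncard (T : Set (Submodule F V)) (hT : T ⊆ M) :
      ((nonzeroVectors T).card : ℤ) = ((Fintype.card F : ℤ) - 1) * T.ncard := by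
    rw [← card_mul_ncard_lines T fun P hP => hlines P (hT hP), Nat.cast_mul,
      Nat.cast_pred (by omega)]
  have hcardD : (D.card : ℤ) = i * ((Fintype.card F : ℤ) ^ s * Fintype.card F - 1) := by
    rw [hncard M subset_rfl, hcard, sub_one_mul_div_sub_one hq, pow_succ]
  have hperp (u : V) (n : ℕ) : (perpIn Q (F ∙ u) M).ncard = n ↔
      ((D.filter (QuadraticMap.polar Q u · = 0)).card : ℤ) = ((Fintype.card F : ℤ) - 1) * n := by
    rw [← nonzeroVectors_perpIn, hncard _ fun _ h => h.1, mul_right_inj' hq1, Nat.cast_inj]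
  have hin : (∀ P ∈ M, (perpIn Q P M).ncard = Fintype.card F ^ s +
        i * (Fintype.card F ^ s - 1) / (Fintype.card F - 1)) ↔
      ∀ x ∈ D, ((D.filter (QuadraticMap.polar Q x · = 0)).card : ℤ) =
        ((Fintype.card F : ℤ) - 1) * Fintype.card F ^ s +
          i * ((Fintype.card F : ℤ) ^ s - 1) := by
    rw [← sub_one_mul_div_sub_one hq, ← mul_add]
    constructor
    · intro h x hx
      exact_mod_cast (hperp x _).1 (h _ (mem_nonzeroVectors.1 hx).2)
    · intro h P hP
      obtain ⟨u, hu, rfl⟩ := hlines P hP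
      exact (hperp u _).2 (by exact_mod_cast h u (mem_nonzeroVectors.2 ⟨hu, hP⟩))
  have hout : (∀ P : Submodule F V, IsSingularPoint Q P → P ∉ M → (perpIn Q P M).ncard =
        i * (Fintype.card F ^ s - 1) / (Fintype.card F - 1)) ↔
      ∀ x ∈ singularVectors Q, x ∉ D →
        ((D.filter (QuadraticMap.polar Q x · = 0)).card : ℤ) =
          i * ((Fintype.card F : ℤ) ^ s - 1) := by
    rw [← sub_one_mul_div_sub_one hq]
    constructor
    · intro h x hx hxD
      obtain ⟨hx0, hxQ⟩ := mem_singularVectors.1 hx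
      exact (hperp x _).1 (h _ ⟨x, hx0, hxQ, rfl⟩ fun hM => hxD (mem_nonzeroVectors.2 ⟨hx0, hM⟩))
    · rintro h P ⟨u, hu0, hu, rfl⟩ hP
      exact (hperp u _).2 (h u (mem_singularVectors.2 ⟨hu0, hu⟩)
        fun hD => hP (mem_nonzeroVectors.1 hD).2)
  have hkey := hQ.tight_inside_iff_tight_outside hD hsmul hcardD
  rw [← hin, ← hout] at hkey
  tfae_have 1 ↔ 2 := hkey
  tfae_have 3 → 1 := And.left
  tfae_have 1 → 3 := fun h => ⟨h, hkey.1 h⟩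
  tfae_finish
end

section
/- Let m ≥ 1 be an integer and let M be a set of singular points of V with |M| = m(q^{r+1} + 1). Then the following are equivalent: (1) |P^⊥ ∩ M| = (m − 1)(q^r + 1) + 1 for every point P ∈ M; (2) |P^⊥ ∩ M| = m(q^r + 1) for every singular point P of V not in M; (3) both (1) and (2) hold, i.e., M is an m-ovoid of the elliptic polar space Q^-(2r+1, q). -/
variable {F V : Type*} [Field F] [AddCommGroup V] [Module F V]

section SingularCounts

open scoped Classical

open Finset

/-- If `T` is stable under translation by the line `⟨u⟩` and each translate class of that line in
`T` contains exactly one vector satisfying `p`, then `p` holds for `1/q` of the vectors of `T`. -/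
theorem card_mul_card_filter_of_translate [Fintype F] (T : Finset V) (u : V) (p : V → Prop)
    (hT : ∀ v ∈ T, ∀ s : F, v + s • u ∈ T) (hp : ∀ v ∈ T, ∃! s : F, p (v + s • u)) :
    Fintype.card F * #{v ∈ T | p v} = #T := by
  rw [← Finset.card_univ, ← Finset.card_product]
  refine Finset.card_bij (fun x _ => x.2 + x.1 • u) ?_ ?_ ?_
  · rintro ⟨s, v⟩ h
    simp only [mem_product, mem_univ, mem_filter, true_and] at h
    exact hT v h.1 s
  · rintro ⟨s, v⟩ h ⟨t, w⟩ h' e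
    simp only [mem_product, mem_univ, mem_filter, true_and] at h h' e
    have hw : w = v + (s - t) • u := by
      rw [sub_smul, ← add_sub_assoc, e, add_sub_cancel_right]
    have hst : s - t = 0 :=
      (hp v h.1).unique (by rw [← hw]; exact h'.2) (by simpa using h.2)
    have : s = t := sub_eq_zero.1 hst
    subst this
    simpa using e
  · intro v hv
    obtain ⟨s, hs, -⟩ := hp v hv
    exact ⟨(-s, v + s • u), by simpa using ⟨hT v hv s, hs⟩, by simp⟩

theorem polarB_add_right (Q : QuadraticForm F V) (u v w : V) :
    polarB Q u (v + w) = polarB Q u v + polarB Q u w :=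
  QuadraticMap.polar_add_right Q u v w

theorem polarB_smul_right (Q : QuadraticForm F V) (s : F) (u v : V) :
    polarB Q u (s • v) = s * polarB Q u v :=
  QuadraticMap.polar_smul_right Q s u v

theorem polarB_smul_left (Q : QuadraticForm F V) (s : F) (u v : V) :
    polarB Q (s • u) v = s * polarB Q u v :=
  QuadraticMap.polar_smul_left Q s u v

theorem polarB_comm (Q : QuadraticForm F V) (u v : V) : polarB Q u v = polarB Q v u :=
  QuadraticMap.polar_comm Q u v

theorem polarB_self_of_singular {Q : QuadraticForm F V} {u : V} (hu : Q u = 0) :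
    polarB Q u u = 0 := by
  have : polarB Q u u = 2 • Q u := QuadraticMap.polar_self Q u
  simpa [hu] using this

theorem map_add_eq_polarB (Q : QuadraticForm F V) (u v : V) :
    Q (u + v) = Q u + Q v + polarB Q u v := by
  unfold polarB; ring

theorem map_add_smul_of_singular {Q : QuadraticForm F V} {u : V} (hu : Q u = 0) (v : V) (s : F) :
    Q (v + s • u) = Q v + s * polarB Q u v := by
  rw [map_add_eq_polarB, QuadraticMap.map_smul, hu, polarB_smul_right, polarB_comm]; simp

theorem existsUnique_add_mul_eq_zero (a : F) {b : F} (hb : b ≠ 0) : ∃! s : F, a + s * b = 0 := by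
  refine ⟨-a / b, by field_simp; ring, fun s hs => ?_⟩
  field_simp
  linear_combination hs

/-- Passing from the singular vectors of `T` to those orthogonal to a singular vector `u`. -/
theorem card_singular_eq_card_perp_add [Fintype F] {Q : QuadraticForm F V} (T : Finset V)
    {u x : V} (hu : Q u = 0) (hux : polarB Q u x ≠ 0)
    (hTu : ∀ v ∈ T, ∀ s : F, v + s • u ∈ T) (hTx : ∀ v ∈ T, ∀ s : F, v + s • x ∈ T) :
    (Fintype.card F : ℤ) ^ 2 * #{v ∈ T | Q v = 0} =
      (Fintype.card F : ℤ) ^ 2 * #{v ∈ T | Q v = 0 ∧ polarB Q u v = 0} +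
        (Fintype.card F - 1 : ℤ) * #T := by
  have h1 : Fintype.card F * #{v ∈ T | polarB Q u v = 0} = #T := by
    refine card_mul_card_filter_of_translate T x _ hTx fun v _ => ?_
    simp only [polarB_add_right, polarB_smul_right]
    exact existsUnique_add_mul_eq_zero _ hux
  have h2 : Fintype.card F * #{v ∈ {v ∈ T | polarB Q u v ≠ 0} | Q v = 0} =
      #{v ∈ T | polarB Q u v ≠ 0} := by
    refine card_mul_card_filter_of_translate _ u _ (fun v hv s => ?_) fun v hv => ?_
    · rw [mem_filter] at hv ⊢
      refine ⟨hTu v hv.1 s, ?_⟩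
      rw [polarB_add_right, polarB_smul_right, polarB_self_of_singular hu]
      simpa using hv.2
    · simp only [map_add_smul_of_singular hu]
      exact existsUnique_add_mul_eq_zero _ (mem_filter.1 hv).2
  have h3 := card_filter_add_card_filter_not (s := T) (fun v => polarB Q u v = 0)
  have h4 := card_filter_add_card_filter_not (s := {v ∈ T | Q v = 0}) (fun v => polarB Q u v = 0)
  rw [filter_filter, filter_filter] at h4
  rw [filter_filter] at h2
  simp only [and_comm (a := ¬ _ = _), ne_eq] at h2 h3 h4
  zify at h1 h2 h3 h4
  rw [← h4]
  linear_combination (Fintype.card F : ℤ) * h2 + (Fintype.card F : ℤ) * h3 - h1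

/-- The number of singular vectors of an elliptic quadric. -/
theorem card_singular_of_elliptic [Fintype F] [Fintype V] {Q : QuadraticForm F V} {r : ℕ}
    (hdim : Module.finrank F V = 2 * r + 2)
    (hnd : ∀ u : V, (∀ v : V, polarB Q u v = 0) → u = 0)
    (hwitt : ∃ W : Submodule F V, Module.finrank F ↥W = r ∧ ∀ v ∈ W, Q v = 0)
    (hwitt' : ¬ ∃ W : Submodule F V, Module.finrank F ↥W = r + 1 ∧ ∀ v ∈ W, Q v = 0) :
    (#{v : V | Q v = 0} : ℤ) =
      Fintype.card F ^ (2 * r + 1) - Fintype.card F ^ (r + 1) + Fintype.card F ^ r := by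
  obtain ⟨W, hWr, hW⟩ := hwitt
  have hcW : #{v : V | v ∈ W} = Fintype.card F ^ r := by
    rw [← hWr, ← Module.card_eq_pow_finrank (K := F) (V := W), Fintype.card_subtype]
  have hWW : ∀ v ∈ W, ∀ w ∈ W, polarB Q v w = 0 := fun v hv w hw => by
    simp [polarB, hW _ (W.add_mem hv hw), hW v hv, hW w hw]
  have hadd : ∀ v, ∀ w ∈ W, Q (v + w) = Q v + polarB Q v w := fun v w hw => by
    rw [map_add_eq_polarB, hW w hw, add_zero]
  let U : Submodule F V := LinearMap.BilinForm.orthogonal Q.polarBilin W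
  have hU : ∀ v, v ∈ U ↔ ∀ w ∈ W, polarB Q w v = 0 := fun v => Iff.rfl
  have hUr : Module.finrank F U = r + 2 := by
    have h := LinearMap.BilinForm.finrank_orthogonal (B := Q.polarBilin)
      (LinearMap.BilinForm.Nondegenerate.ofSeparatingLeft hnd) W
    change Module.finrank F U = _ at h
    omega
  have hcU : #{v : V | v ∈ U} = Fintype.card F ^ (r + 2) := by
    rw [← hUr, ← Module.card_eq_pow_finrank (K := F) (V := U), Fintype.card_subtype]
  have hUW : ∀ v, (v ∈ U ∧ Q v = 0) ↔ v ∈ W := by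
    refine fun v => ⟨fun ⟨hvU, hv⟩ => ?_, fun hv => ⟨fun w hw => hWW w hw v hv, hW v hv⟩⟩
    by_contra hvW
    refine hwitt' ⟨W ⊔ F ∙ v, ?_, fun x hx => ?_⟩
    · rw [Submodule.finrank_sup_span_singleton hvW, hWr]
    · obtain ⟨w, hw, y, hy, rfl⟩ := Submodule.mem_sup.1 hx
      obtain ⟨s, rfl⟩ := Submodule.mem_span_singleton.1 hy
      rw [map_add_eq_polarB, hW w hw, QuadraticMap.map_smul, hv, polarB_smul_right,
        (hU v).1 hvU w hw]
      simp
  set T : Finset V := {v : V | v ∉ U} with hT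
  have hcT : #{v : V | v ∈ U} + #T = Fintype.card V := by
    rw [hT, card_filter_add_card_filter_not, card_univ]
  rw [Module.card_eq_pow_finrank (K := F) (V := V), hdim, hcU] at hcT
  -- count the pairs `(v, w) ∈ T × W` with `Q (v + w) = 0` in two ways
  have hZ : Fintype.card F * #{v ∈ T | Q v = 0} = #T := by
    have e1 : ∀ w ∈ ({v : V | v ∈ W} : Finset V),
        #{v ∈ T | Q (v + w) = 0} = #{v ∈ T | Q v = 0} := by
      intro w hw
      have hwW : w ∈ W := by simpa using hw
      have hwU : w ∈ U := ((hUW w).2 hwW).1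
      refine card_bij (fun v _ => v + w) (fun v hv => ?_) (fun _ _ _ _ h => add_right_cancel h)
        fun v hv => ⟨v - w, ?_, sub_add_cancel v w⟩
      · simp only [hT, mem_filter, mem_univ, true_and] at hv ⊢
        exact ⟨fun h => hv.1 ((U.add_mem_iff_left hwU).1 h), hv.2⟩
      · simp only [hT, mem_filter, mem_univ, true_and, sub_add_cancel] at hv ⊢
        exact ⟨fun h => hv.1 ((U.sub_mem_iff_left hwU).1 h), hv.2⟩
    have e2 : ∀ v ∈ T, Fintype.card F * #{w ∈ ({v : V | v ∈ W} : Finset V) | Q (v + w) = 0} =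
        #{v : V | v ∈ W} := by
      intro v hv
      have hvU : v ∉ U := by simpa [hT] using hv
      rw [hU] at hvU
      push Not at hvU
      obtain ⟨x, hx, hxv⟩ := hvU
      refine card_mul_card_filter_of_translate _ x _ (fun w hw s => ?_) fun w hw => ?_
      · simp only [mem_filter, mem_univ, true_and] at hw ⊢
        exact W.add_mem hw (W.smul_mem s hx)
      · have hw : w ∈ W := by simpa using hw
        have : ∀ s : F, Q (v + (w + s • x)) = (Q v + polarB Q v w) + s * polarB Q x v := fun s => by
          rw [hadd _ _ (W.add_mem hw (W.smul_mem s hx)), polarB_add_right, polarB_smul_right,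
            polarB_comm Q v x]; ring
        simp only [this]
        exact existsUnique_add_mul_eq_zero _ hxv
    have e3 := sum_card_bipartiteAbove_eq_sum_card_bipartiteBelow
      (s := T) (t := ({v : V | v ∈ W} : Finset V)) (fun v w => Q (v + w) = 0)
    simp only [bipartiteAbove, bipartiteBelow] at e3
    rw [sum_congr rfl e1, sum_const, smul_eq_mul] at e3
    have e4 : #T * #{v : V | v ∈ W} =
        #{v : V | v ∈ W} * (Fintype.card F * #{v ∈ T | Q v = 0}) := by
      rw [← smul_eq_mul, ← sum_const, ← sum_congr rfl e2, ← mul_sum, e3]; ring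
    rw [mul_comm] at e4
    refine (Nat.eq_of_mul_eq_mul_left ?_ e4).symm
    rw [hcW]; exact pow_pos Fintype.card_pos _
  have hsplit := card_filter_add_card_filter_not (s := ({v : V | Q v = 0} : Finset V))
    (fun v => v ∈ U)
  have hin : #{v ∈ ({v : V | Q v = 0} : Finset V) | v ∈ U} = Fintype.card F ^ r := by
    rw [← hcW, filter_filter]
    congr 1
    ext v
    simp [← hUW v, and_comm]
  have hout : ({v ∈ ({v : V | Q v = 0} : Finset V) | v ∉ U} : Finset V) = {v ∈ T | Q v = 0} := by
    rw [hT, filter_filter, filter_filter]; simp only [and_comm]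
  rw [hin, hout] at hsplit
  have hq : (Fintype.card F : ℤ) ≠ 0 := by exact_mod_cast Fintype.card_ne_zero
  zify at hsplit hZ hcT
  refine mul_left_cancel₀ hq ?_
  rw [← hsplit]
  linear_combination hZ + hcT

/-- The number of singular vectors orthogonal to a nonzero singular vector. -/
theorem card_singular_perp [Fintype F] [Fintype V] {Q : QuadraticForm F V} {r : ℕ}
    (hdim : Module.finrank F V = 2 * r + 2)
    (hnd : ∀ u : V, (∀ v : V, polarB Q u v = 0) → u = 0)
    (hZ : (#{v : V | Q v = 0} : ℤ) =
      Fintype.card F ^ (2 * r + 1) - Fintype.card F ^ (r + 1) + Fintype.card F ^ r)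
    {u : V} (hu0 : u ≠ 0) (hu : Q u = 0) :
    (#{v : V | Q v = 0 ∧ polarB Q u v = 0} : ℤ) =
      Fintype.card F ^ (2 * r) - Fintype.card F ^ (r + 1) + Fintype.card F ^ r := by
  obtain ⟨x, hx⟩ : ∃ x, polarB Q u x ≠ 0 := by
    by_contra! h
    exact hu0 (hnd u h)
  have h := card_singular_eq_card_perp_add (univ : Finset V) hu hx (by simp) (by simp)
  rw [hZ, card_univ, Module.card_eq_pow_finrank (K := F) (V := V), hdim] at h
  have hq : (Fintype.card F : ℤ) ≠ 0 := by exact_mod_cast Fintype.card_ne_zero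
  refine mul_left_cancel₀ (pow_ne_zero 2 hq) ?_
  push_cast at h
  linear_combination -h

/-- The number of singular vectors orthogonal to two independent orthogonal singular vectors. -/
theorem card_singular_perp_perp_of_orthogonal [Fintype F] [Fintype V] {Q : QuadraticForm F V}
    {k : ℕ} (hdim : Module.finrank F V = 2 * (k + 1) + 2)
    (hnd : ∀ u : V, (∀ v : V, polarB Q u v = 0) → u = 0)
    (hZ : (#{v : V | Q v = 0} : ℤ) = Fintype.card F ^ (2 * (k + 1) + 1) -
      Fintype.card F ^ (k + 1 + 1) + Fintype.card F ^ (k + 1))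
    {u w : V} (hw0 : w ≠ 0) (hu : Q u = 0) (hw : Q w = 0) (huw : polarB Q w u = 0)
    (hind : u ∉ Submodule.span F {w}) :
    (#{v : V | Q v = 0 ∧ polarB Q u v = 0 ∧ polarB Q w v = 0} : ℤ) =
      Fintype.card F ^ (2 * k + 1) - Fintype.card F ^ (k + 2) + Fintype.card F ^ (k + 1) := by
  obtain ⟨x, hwx, hux⟩ : ∃ x, polarB Q w x = 0 ∧ polarB Q u x ≠ 0 := by
    by_contra! h
    have hker : LinearMap.ker (Q.polarBilin w) ≤ LinearMap.ker (Q.polarBilin u) := h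
    obtain ⟨c, hc⟩ : ∃ c : F, Q.polarBilin u = c • Q.polarBilin w := by
      have h := mem_span_of_iInf_ker_le_ker (L := fun _ : Unit => Q.polarBilin w)
        (K := Q.polarBilin u) (by simpa using hker)
      rw [Set.range_const, Submodule.mem_span_singleton] at h
      exact h.imp fun _ => Eq.symm
    refine hind (Submodule.mem_span_singleton.2 ⟨c, ?_⟩)
    refine (sub_eq_zero.1 (hnd _ fun v => ?_)).symm
    change Q.polarBilin (u - c • w) v = 0
    rw [map_sub, map_smul, hc, sub_self, LinearMap.zero_apply]
  obtain ⟨y, hy⟩ : ∃ y, polarB Q w y ≠ 0 := by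
    by_contra! h
    exact hw0 (hnd w h)
  have hstable : ∀ z, polarB Q w z = 0 → ∀ v ∈ ({v : V | polarB Q w v = 0} : Finset V), ∀ s : F,
      v + s • z ∈ ({v : V | polarB Q w v = 0} : Finset V) := by
    intro z hz v hv s
    simp only [mem_filter, mem_univ, true_and] at hv ⊢
    rw [polarB_add_right, polarB_smul_right, hz, hv]; simp
  have h := card_singular_eq_card_perp_add {v : V | polarB Q w v = 0} hu hux
    (hstable u huw) (hstable x hwx)
  have hT : Fintype.card F * #{v : V | polarB Q w v = 0} = Fintype.card V := by
    rw [← card_univ (α := V)]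
    refine card_mul_card_filter_of_translate _ y _ (by simp) fun v _ => ?_
    simp only [polarB_add_right, polarB_smul_right]
    exact existsUnique_add_mul_eq_zero _ hy
  rw [Module.card_eq_pow_finrank (K := F) (V := V), hdim] at hT
  have h1 := card_singular_perp hdim hnd hZ hw0 hw
  have e1 : ({v ∈ ({v : V | polarB Q w v = 0} : Finset V) | Q v = 0} : Finset V) =
      ({v : V | Q v = 0 ∧ polarB Q w v = 0} : Finset V) := by
    rw [filter_filter]; simp only [and_comm]
  have e2 : ({v ∈ ({v : V | polarB Q w v = 0} : Finset V) | Q v = 0 ∧ polarB Q u v = 0}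
      : Finset V) = ({v : V | Q v = 0 ∧ polarB Q u v = 0 ∧ polarB Q w v = 0} : Finset V) := by
    rw [filter_filter]; ext v; simp only [mem_filter]; tauto
  rw [e1, e2, h1] at h
  have hq : (Fintype.card F : ℤ) ≠ 0 := by exact_mod_cast Fintype.card_ne_zero
  zify at hT
  refine mul_left_cancel₀ (pow_ne_zero 3 hq) ?_
  linear_combination -(Fintype.card F : ℤ) * h - (Fintype.card F - 1 : ℤ) * hT

/-- The number of singular vectors orthogonal to two non-orthogonal singular vectors. -/
theorem card_singular_perp_perp_of_not_orthogonal [Fintype F] [Fintype V] {Q : QuadraticForm F V}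
    {k : ℕ} (hdim : Module.finrank F V = 2 * (k + 1) + 2)
    (hnd : ∀ u : V, (∀ v : V, polarB Q u v = 0) → u = 0)
    (hZ : (#{v : V | Q v = 0} : ℤ) = Fintype.card F ^ (2 * (k + 1) + 1) -
      Fintype.card F ^ (k + 1 + 1) + Fintype.card F ^ (k + 1))
    {u w : V} (hw0 : w ≠ 0) (hw : Q w = 0) (huw : polarB Q u w ≠ 0) :
    (#{v : V | Q v = 0 ∧ polarB Q u v = 0 ∧ polarB Q w v = 0} : ℤ) =
      Fintype.card F ^ (2 * k + 1) - Fintype.card F ^ (k + 1) + Fintype.card F ^ k := by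
  have h : Fintype.card F * #{v ∈ ({v : V | Q v = 0 ∧ polarB Q w v = 0} : Finset V) |
      polarB Q u v = 0} = #{v : V | Q v = 0 ∧ polarB Q w v = 0} := by
    refine card_mul_card_filter_of_translate _ w _ (fun v hv s => ?_) fun v _ => ?_
    · simp only [mem_filter, mem_univ, true_and] at hv ⊢
      rw [map_add_smul_of_singular hw, polarB_add_right, polarB_smul_right, hv.1, hv.2,
        polarB_self_of_singular hw]
      simp
    · simp only [polarB_add_right, polarB_smul_right]
      exact existsUnique_add_mul_eq_zero _ huw
  have e : ({v ∈ ({v : V | Q v = 0 ∧ polarB Q w v = 0} : Finset V) | polarB Q u v = 0}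
      : Finset V) = ({v : V | Q v = 0 ∧ polarB Q u v = 0 ∧ polarB Q w v = 0} : Finset V) := by
    rw [filter_filter]; ext v; simp only [mem_filter]; tauto
  rw [e] at h
  have hq : (Fintype.card F : ℤ) ≠ 0 := by exact_mod_cast Fintype.card_ne_zero
  zify at h
  rw [card_singular_perp hdim hnd hZ hw0 hw] at h
  refine mul_left_cancel₀ hq ?_
  linear_combination h

theorem card_span_eq_span [Fintype F] [Fintype V] {u : V} (hu : u ≠ 0) :
    #{v : V | v ≠ 0 ∧ Submodule.span F {v} = Submodule.span F {u}} = Fintype.card F - 1 := by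
  rw [← Fintype.card_units, ← card_univ]
  symm
  refine card_bij (fun (c : Fˣ) _ => (c : F) • u) (fun c _ => ?_) (fun c _ d _ h => ?_)
    fun v hv => ?_
  · simp only [mem_filter, mem_univ, true_and]
    exact ⟨smul_ne_zero c.ne_zero hu, Submodule.span_singleton_smul_eq c.isUnit u⟩
  · exact Units.ext (smul_left_injective F hu h)
  · simp only [mem_filter, mem_univ, true_and] at hv
    obtain ⟨c, hc⟩ := Submodule.mem_span_singleton.1
      (hv.2 ▸ Submodule.mem_span_singleton_self v : v ∈ Submodule.span F {u})
    have hc0 : c ≠ 0 := by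
      rintro rfl
      exact hv.1 (by simpa using hc.symm)
    exact ⟨Units.mk0 c hc0, mem_univ _, hc⟩

/-- Each point of a set `N` of points accounts for `q - 1` nonzero vectors. -/
theorem card_vectors_of_points [Fintype F] [Fintype V] (N : Set (Submodule F V))
    (hN : ∀ P ∈ N, ∃ u : V, u ≠ 0 ∧ P = Submodule.span F {u}) :
    #{v : V | v ≠ 0 ∧ Submodule.span F {v} ∈ N} = (Fintype.card F - 1) * N.ncard := by
  have hfin : N.Finite := Set.toFinite N
  rw [Set.ncard_eq_toFinset_card N hfin, mul_comm]
  rw [card_eq_sum_card_fiberwise (f := fun v => Submodule.span F {v}) (t := hfin.toFinset)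
    (fun v hv => by simpa using (mem_filter.1 hv).2.2)]
  refine sum_const_nat fun P hP => ?_
  have hPN : P ∈ N := by simpa using hP
  obtain ⟨u, hu, rfl⟩ := hN P hPN
  rw [← card_span_eq_span (F := F) hu, filter_filter]
  congr 1
  ext v
  simp only [mem_filter, mem_univ, true_and]
  exact ⟨fun h => ⟨h.1.1, h.2⟩, fun h => ⟨⟨h.1, h.2 ▸ hPN⟩, h.2⟩⟩

/-- The collinearity relation on nonzero singular vectors of an elliptic quadric is strongly
regular: the number of common neighbours of `x` and `y`. -/
theorem card_common_perp [Fintype F] [Fintype V] {Q : QuadraticForm F V}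
    {k : ℕ} (hdim : Module.finrank F V = 2 * (k + 1) + 2)
    (hnd : ∀ u : V, (∀ v : V, polarB Q u v = 0) → u = 0)
    (hZ : (#{v : V | Q v = 0} : ℤ) = Fintype.card F ^ (2 * (k + 1) + 1) -
      Fintype.card F ^ (k + 1 + 1) + Fintype.card F ^ (k + 1))
    {x y : V} (hx0 : x ≠ 0) (hx : Q x = 0) (hy0 : y ≠ 0) (hy : Q y = 0) {q p : ℤ}
    (hq : q = Fintype.card F) (hp : p = q ^ k) :
    (#{u : V | (u ≠ 0 ∧ Q u = 0) ∧ polarB Q u x = 0 ∧ polarB Q u y = 0} : ℤ) =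
      (q * p ^ 2 - q * p + p - 1) + -p * (q - 1) ^ 2 * (if polarB Q x y = 0 then 1 else 0) +
        q * p ^ 2 * (q - 1) *
          (if Submodule.span F {y} = Submodule.span F {x} then 1 else 0) := by
  have hmem : (0 : V) ∈ ({u : V | Q u = 0 ∧ polarB Q x u = 0 ∧ polarB Q y u = 0} : Finset V) :=
    mem_filter.2 ⟨mem_univ _, by simp [polarB]⟩
  have h0 : (#{u : V | (u ≠ 0 ∧ Q u = 0) ∧ polarB Q u x = 0 ∧ polarB Q u y = 0} : ℤ) =
      #{u : V | Q u = 0 ∧ polarB Q x u = 0 ∧ polarB Q y u = 0} - 1 := by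
    have : ({u : V | (u ≠ 0 ∧ Q u = 0) ∧ polarB Q u x = 0 ∧ polarB Q u y = 0} : Finset V) =
        ({u : V | Q u = 0 ∧ polarB Q x u = 0 ∧ polarB Q y u = 0} : Finset V).erase 0 := by
      ext u
      simp only [mem_filter, mem_univ, true_and, mem_erase, polarB_comm Q u, and_assoc]
    rw [this, card_erase_of_mem hmem, Nat.cast_sub (card_pos.2 ⟨0, hmem⟩), Nat.cast_one]
  rw [h0]
  by_cases hxy : polarB Q x y = 0
  · rw [if_pos hxy]
    by_cases hs : Submodule.span F {y} = Submodule.span F {x}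
    · rw [if_pos hs]
      obtain ⟨c, rfl⟩ := Submodule.mem_span_singleton.1
        (hs ▸ Submodule.mem_span_singleton_self y : y ∈ Submodule.span F {x})
      have e : ({u : V | Q u = 0 ∧ polarB Q x u = 0 ∧ polarB Q (c • x) u = 0} : Finset V) =
          ({u : V | Q u = 0 ∧ polarB Q x u = 0} : Finset V) := by
        ext u
        simp only [mem_filter, mem_univ, true_and, polarB_smul_left]
        exact ⟨fun h => ⟨h.1, h.2.1⟩, fun h => ⟨h.1, h.2, by rw [h.2, mul_zero]⟩⟩
      rw [e, card_singular_perp hdim hnd hZ hx0 hx, ← hq, hp]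
      ring
    · rw [if_neg hs, card_singular_perp_perp_of_orthogonal hdim hnd hZ hy0 hx hy
        (by rw [polarB_comm, hxy]) ?_, ← hq, hp]
      · ring
      · intro hmem
        obtain ⟨c, rfl⟩ := Submodule.mem_span_singleton.1 hmem
        have hc : c ≠ 0 := by
          rintro rfl
          exact hx0 (zero_smul F y)
        exact hs (Submodule.span_singleton_smul_eq hc.isUnit y).symm
  · have hs : Submodule.span F {y} ≠ Submodule.span F {x} := by
      intro hs
      obtain ⟨c, rfl⟩ := Submodule.mem_span_singleton.1
        (hs ▸ Submodule.mem_span_singleton_self y : y ∈ Submodule.span F {x})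
      rw [polarB_smul_right, polarB_self_of_singular hx, mul_zero] at hxy
      exact hxy rfl
    rw [if_neg hxy, if_neg hs, card_singular_perp_perp_of_not_orthogonal hdim hnd hZ hy0 hy hxy,
      ← hq, hp]
    ring

/-- First and second moments of `u ↦ |u^⊥ ∩ X|` over the nonzero singular vectors `u`, for a set
`X` of nonzero singular vectors closed under nonzero scalars. -/
theorem sum_card_perp [Fintype F] [Fintype V] {Q : QuadraticForm F V}
    {k : ℕ} (hdim : Module.finrank F V = 2 * (k + 1) + 2)
    (hnd : ∀ u : V, (∀ v : V, polarB Q u v = 0) → u = 0)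
    (hZ : (#{v : V | Q v = 0} : ℤ) = Fintype.card F ^ (2 * (k + 1) + 1) -
      Fintype.card F ^ (k + 1 + 1) + Fintype.card F ^ (k + 1))
    {q p : ℤ} (hq : q = Fintype.card F) (hp : p = q ^ k) (X : Finset V)
    (hX : ∀ x ∈ X, x ≠ 0 ∧ Q x = 0)
    (hXs : ∀ x ∈ X, ∀ y, y ≠ 0 → Submodule.span F {y} = Submodule.span F {x} → y ∈ X) :
    (∑ u : V with u ≠ 0 ∧ Q u = 0, (#{x ∈ X | polarB Q u x = 0} : ℤ) =
      #X * (q ^ 2 * p ^ 2 - q ^ 2 * p + q * p - 1)) ∧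
    (∑ u : V with u ≠ 0 ∧ Q u = 0, (#{x ∈ X | polarB Q u x = 0} : ℤ) ^ 2 =
      (q * p ^ 2 - q * p + p - 1) * (#X : ℤ) ^ 2 +
        -p * (q - 1) ^ 2 * ∑ x ∈ X, (#{y ∈ X | polarB Q x y = 0} : ℤ) +
        q * p ^ 2 * (q - 1) * ((q - 1) * #X)) := by
  have ha : ∀ u, (#{x ∈ X | polarB Q u x = 0} : ℤ) =
      ∑ x ∈ X, if polarB Q u x = 0 then 1 else 0 := fun u => by
    rw [card_filter]; push_cast; rfl
  constructor
  · simp only [ha]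
    rw [sum_comm, ← nsmul_eq_mul, ← sum_const]
    refine sum_congr rfl fun x hx => ?_
    have h := card_common_perp hdim hnd hZ (hX x hx).1 (hX x hx).2 (hX x hx).1 (hX x hx).2 hq hp
    simp only [polarB_self_of_singular (hX x hx).2, and_self, if_true] at h
    rw [← sum_filter, filter_filter, sum_const, nsmul_eq_mul, h]
    ring
  · have h : ∀ x ∈ X, ∀ y ∈ X,
        ∑ u : V with u ≠ 0 ∧ Q u = 0,
          (if polarB Q u x = 0 then (1 : ℤ) else 0) * (if polarB Q u y = 0 then 1 else 0) =
        (q * p ^ 2 - q * p + p - 1) + -p * (q - 1) ^ 2 * (if polarB Q x y = 0 then 1 else 0) +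
        q * p ^ 2 * (q - 1) *
          (if Submodule.span F {y} = Submodule.span F {x} then 1 else 0) := by
      intro x hx y hy
      rw [← card_common_perp hdim hnd hZ (hX x hx).1 (hX x hx).2 (hX y hy).1 (hX y hy).2 hq hp,
        ← filter_filter (fun u => u ≠ 0 ∧ Q u = 0), card_filter]
      push_cast
      refine sum_congr rfl fun u _ => ?_
      rw [ite_and]
      split_ifs <;> simp
    have hspan : ∀ x ∈ X,
        ∑ y ∈ X, (if Submodule.span F {y} = Submodule.span F {x} then (1 : ℤ) else 0) =
          q - 1 := by
      intro x hx
      have e : ({y ∈ X | Submodule.span F {y} = Submodule.span F {x}} : Finset V) =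
          ({y : V | y ≠ 0 ∧ Submodule.span F {y} = Submodule.span F {x}} : Finset V) := by
        ext y
        simp only [mem_filter, mem_univ, true_and]
        exact ⟨fun h => ⟨(hX y h.1).1, h.2⟩, fun h => ⟨hXs x hx y h.1 h.2, h.2⟩⟩
      rw [← sum_filter, sum_const, e, card_span_eq_span (hX x hx).1,
        nsmul_eq_mul, mul_one, Nat.cast_sub Fintype.card_pos, hq, Nat.cast_one]
    simp only [ha, sq, sum_mul_sum]
    rw [sum_comm]
    simp only [← sq]
    have h' : ∀ x ∈ X, ∑ u : V with u ≠ 0 ∧ Q u = 0, ∑ y ∈ X,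
          (if polarB Q u x = 0 then (1 : ℤ) else 0) * (if polarB Q u y = 0 then 1 else 0) =
        #X * (q * p ^ 2 - q * p + p - 1) +
          -p * (q - 1) ^ 2 * ∑ y ∈ X, (if polarB Q x y = 0 then 1 else 0) +
          q * p ^ 2 * (q - 1) * (q - 1) := by
      intro x hx
      rw [sum_comm, sum_congr rfl (h x hx), sum_add_distrib, sum_add_distrib, ← mul_sum,
        ← mul_sum, hspan x hx, sum_const, nsmul_eq_mul]
    rw [sum_congr rfl h', sum_add_distrib, sum_add_distrib, sum_const, sum_const,
      ← mul_sum, nsmul_eq_mul, nsmul_eq_mul]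
    ring

/-- The deviation `f` of `u ↦ |u^⊥ ∩ X|` from the values prescribed for an `m`-ovoid has sum zero,
and its sum of squares is a multiple of its sum over `X`. -/
theorem sum_ovoid_deviation [Fintype F] [Fintype V] {Q : QuadraticForm F V}
    {k : ℕ} (hdim : Module.finrank F V = 2 * (k + 1) + 2)
    (hnd : ∀ u : V, (∀ v : V, polarB Q u v = 0) → u = 0)
    (hZ : (#{v : V | Q v = 0} : ℤ) = Fintype.card F ^ (2 * (k + 1) + 1) -
      Fintype.card F ^ (k + 1 + 1) + Fintype.card F ^ (k + 1))
    {q p m : ℤ} (hq : q = Fintype.card F) (hp : p = q ^ k) (X : Finset V)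
    (hX : ∀ x ∈ X, x ≠ 0 ∧ Q x = 0)
    (hXs : ∀ x ∈ X, ∀ y, y ≠ 0 → Submodule.span F {y} = Submodule.span F {x} → y ∈ X)
    (hcard : (#X : ℤ) = (q - 1) * (m * (q ^ 2 * p + 1))) {f : V → ℤ}
    (hf : ∀ u, f u = #{x ∈ X | polarB Q u x = 0} +
      (q - 1) * (q * p) * (if u ∈ X then 1 else 0) - (q - 1) * (m * (q * p + 1))) :
    ∑ u : V with u ≠ 0 ∧ Q u = 0, f u = 0 ∧
    ∑ u : V with u ≠ 0 ∧ Q u = 0, f u ^ 2 = (q - 1) * (p + q * p) * ∑ u ∈ X, f u := by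
  obtain ⟨h1, h2⟩ := sum_card_perp hdim hnd hZ hq hp X hX hXs
  have hS : (#{u : V | u ≠ 0 ∧ Q u = 0} : ℤ) = q ^ 3 * p ^ 2 - q ^ 2 * p + q * p - 1 := by
    have : ({u : V | u ≠ 0 ∧ Q u = 0} : Finset V) = ({u : V | Q u = 0} : Finset V).erase 0 := by
      ext u
      simp only [mem_filter, mem_univ, true_and, mem_erase]
    rw [this, card_erase_of_mem (by simp), Nat.cast_sub, hZ, ← hq, hp]
    · push_cast; ring
    · exact card_pos.2 ⟨0, by simp⟩
  have hin : ∀ g : V → ℤ,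
      ∑ u : V with u ≠ 0 ∧ Q u = 0, g u * (if u ∈ X then 1 else 0) = ∑ u ∈ X, g u := by
    intro g
    simp only [mul_ite, mul_one, mul_zero]
    rw [← sum_filter]
    congr 1
    ext u
    simp only [mem_filter, mem_univ, true_and, and_iff_right_iff_imp]
    exact hX u
  set a : V → ℤ := fun u => #{x ∈ X | polarB Q u x = 0} with ha
  change ∑ u : V with u ≠ 0 ∧ Q u = 0, a u = _ at h1
  change ∑ u : V with u ≠ 0 ∧ Q u = 0, a u ^ 2 = _ + _ * ∑ x ∈ X, a x + _ at h2
  set c := (q - 1) * (m * (q * p + 1)) with hc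
  set d := (q - 1) * (q * p) with hd
  have hfX : ∑ u ∈ X, f u = ∑ u ∈ X, a u + #X * (d - c) := by
    rw [← nsmul_eq_mul, ← sum_const, ← sum_add_distrib]
    refine sum_congr rfl fun u hu => ?_
    rw [hf, if_pos hu]; ring
  have hfS : ∑ u : V with u ≠ 0 ∧ Q u = 0, f u =
      ∑ u : V with u ≠ 0 ∧ Q u = 0, a u + #X * d - #{u : V | u ≠ 0 ∧ Q u = 0} * c := by
    rw [← nsmul_eq_mul, ← nsmul_eq_mul, ← sum_const, ← sum_const, ← hin, ← sum_add_distrib,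
      ← sum_sub_distrib]
    exact sum_congr rfl fun u _ => hf u
  have hfsq : ∑ u : V with u ≠ 0 ∧ Q u = 0, f u ^ 2 =
      ∑ u : V with u ≠ 0 ∧ Q u = 0, a u ^ 2 + (-2 * c) * ∑ u : V with u ≠ 0 ∧ Q u = 0, a u +
        #{u : V | u ≠ 0 ∧ Q u = 0} * c ^ 2 + (2 * d * ∑ u ∈ X, a u + #X * (d ^ 2 - 2 * c * d)) := by
    rw [← nsmul_eq_mul, ← nsmul_eq_mul, ← sum_const, ← sum_const, mul_sum, mul_sum,
      ← sum_add_distrib (s := X), ← hin, ← sum_add_distrib, ← sum_add_distrib, ← sum_add_distrib]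
    refine sum_congr rfl fun u _ => ?_
    rw [hf]
    change (a u + _ - _) ^ 2 = _
    split_ifs <;> ring
  constructor
  · rw [hfS, h1, hS, hcard, hc, hd]; ring
  · rw [hfsq, hfX, h1, h2, hS, hcard, hc, hd]; ring

end SingularCounts

open Finset in
/-- Let `F` be a finite field of order `q`, `r ≥ 2`, and `V` a
`(2r+2)`-dimensional `F`-space with a quadratic form `Q` whose polar form is
nondegenerate and whose Witt index is `r` (elliptic quadric `Q⁻(2r+1, q)`).
Let `m ≥ 1` and `M` a set of singular points with `|M| = m(q^{r+1} + 1)`.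
The following are equivalent:
(1) `|P^⊥ ∩ M| = (m − 1)(q^r + 1) + 1` for all `P ∈ M`;
(2) `|P^⊥ ∩ M| = m(q^r + 1)` for all singular points `P ∉ M`;
(3) both (1) and (2), i.e. `M` is an `m`-ovoid. -/
theorem stmt_14 {F V : Type*} [Field F] [Fintype F] [AddCommGroup V] [Module F V]
    (Q : QuadraticForm F V) (r : ℕ) (hr : 2 ≤ r)
    (hdim : Module.finrank F V = 2 * r + 2)
    (hnd : ∀ u : V, (∀ v : V, polarB Q u v = 0) → u = 0)
    (hwitt : ∃ W : Submodule F V, Module.finrank F ↥W = r ∧ ∀ v ∈ W, Q v = 0)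
    (hwitt' : ¬ ∃ W : Submodule F V, Module.finrank F ↥W = r + 1 ∧ ∀ v ∈ W, Q v = 0)
    (m : ℕ) (hm : 1 ≤ m) (M : Set (Submodule F V))
    (hM : ∀ P ∈ M, IsSingularPoint Q P)
    (hcard : M.ncard = m * (Fintype.card F ^ (r + 1) + 1)) :
    List.TFAE [
      ∀ P ∈ M, (perpIn Q P M).ncard = (m - 1) * (Fintype.card F ^ r + 1) + 1,
      ∀ P : Submodule F V, IsSingularPoint Q P → P ∉ M →
        (perpIn Q P M).ncard = m * (Fintype.card F ^ r + 1),
      (∀ P ∈ M, (perpIn Q P M).ncard = (m - 1) * (Fintype.card F ^ r + 1) + 1) ∧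
      ∀ P : Submodule F V, IsSingularPoint Q P → P ∉ M →
        (perpIn Q P M).ncard = m * (Fintype.card F ^ r + 1)] := by
  classical
  have : Module.Finite F V := Module.finite_of_finrank_pos (by omega)
  have : Finite V := Module.finite_of_finite F
  have : Fintype V := Fintype.ofFinite V
  have hZ := card_singular_of_elliptic hdim hnd hwitt hwitt'
  obtain ⟨k, rfl⟩ : ∃ k, r = k + 1 := ⟨r - 1, by omega⟩
  obtain ⟨q, hq⟩ : ∃ q : ℤ, q = Fintype.card F := ⟨_, rfl⟩
  obtain ⟨p, hp⟩ : ∃ p : ℤ, p = q ^ k := ⟨_, rfl⟩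
  have hq1 : 0 < q - 1 := by
    have := Fintype.one_lt_card (α := F)
    rw [hq]; omega
  have hqc : ((Fintype.card F - 1 : ℕ) : ℤ) = q - 1 := by
    rw [Nat.cast_sub Fintype.card_pos, hq, Nat.cast_one]
  have hsing : ∀ v : V, Submodule.span F {v} ∈ M → Q v = 0 := by
    intro v hv
    obtain ⟨u, -, hu, e⟩ := hM _ hv
    obtain ⟨c, rfl⟩ := Submodule.mem_span_singleton.1
      (e ▸ Submodule.mem_span_singleton_self v : v ∈ Submodule.span F {u})
    rw [QuadraticMap.map_smul, hu, smul_zero]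
  have hpoint : ∀ P ∈ M, ∃ u : V, u ≠ 0 ∧ P = Submodule.span F {u} := fun P hP =>
    let ⟨u, h0, _, h⟩ := hM P hP
    ⟨u, h0, h⟩
  set X : Finset V := {v : V | v ≠ 0 ∧ Submodule.span F {v} ∈ M} with hXdef
  have hmemX : ∀ v, v ∈ X ↔ v ≠ 0 ∧ Submodule.span F {v} ∈ M := fun v => by simp [hXdef]
  have hX : ∀ x ∈ X, x ≠ 0 ∧ Q x = 0 := fun x hx =>
    ⟨((hmemX x).1 hx).1, hsing x ((hmemX x).1 hx).2⟩
  have hXcard : (#X : ℤ) = (q - 1) * (m * (q ^ 2 * p + 1)) := by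
    have h := card_vectors_of_points M hpoint
    rw [hcard] at h
    zify at h
    rw [hXdef]
    convert h using 1
    rw [hqc, ← hq, hp]; ring
  have hperp : ∀ u, (#{x ∈ X | polarB Q u x = 0} : ℤ) =
      (q - 1) * (perpIn Q (Submodule.span F {u}) M).ncard := by
    intro u
    have h := card_vectors_of_points (perpIn Q (Submodule.span F {u}) M)
      fun P hP => hpoint P hP.1
    rw [← hqc, ← Nat.cast_mul, ← h, hXdef, filter_filter]
    congr 2
    ext v
    simp only [mem_filter, mem_univ, true_and, perpIn, Set.mem_ofPred_eq, and_assoc,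
      Submodule.mem_span_singleton, forall_exists_index, forall_apply_eq_imp_iff,
      polarB_smul_left, polarB_smul_right]
    refine and_congr_right fun _ => and_congr_right fun _ =>
      ⟨fun h s t => by rw [h]; simp, fun h => by simpa using h 1 1⟩
  obtain ⟨f, hf⟩ : ∃ f : V → ℤ, ∀ u, f u = #{x ∈ X | polarB Q u x = 0} +
      (q - 1) * (q * p) * (if u ∈ X then 1 else 0) - (q - 1) * (m * (q * p + 1)) :=
    ⟨_, fun _ => rfl⟩
  obtain ⟨hsum, hsq⟩ := sum_ovoid_deviation hdim hnd hZ hq hp X hX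
    (fun x hx y hy0 hy => (hmemX y).2 ⟨hy0, hy ▸ ((hmemX x).1 hx).2⟩) hXcard hf
  have hqp : ((Fintype.card F ^ (k + 1) : ℕ) : ℤ) = q * p := by
    rw [hp, hq]; push_cast; ring
  have hfin : ∀ u ∈ X, (f u = 0 ↔ (perpIn Q (Submodule.span F {u}) M).ncard =
      (m - 1) * (Fintype.card F ^ (k + 1) + 1) + 1) := by
    intro u hu
    rw [hf, if_pos hu, hperp, ← Nat.cast_inj (R := ℤ), Nat.cast_add, Nat.cast_mul, Nat.cast_add,
      hqp, Nat.cast_sub hm, Nat.cast_one]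
    refine ⟨fun h => mul_left_cancel₀ hq1.ne' ?_, fun h => ?_⟩
    · linear_combination h
    · linear_combination (q - 1) * h
  have hfout : ∀ u ∉ X, (f u = 0 ↔ (perpIn Q (Submodule.span F {u}) M).ncard =
      m * (Fintype.card F ^ (k + 1) + 1)) := by
    intro u hu
    rw [hf, if_neg hu, hperp, ← Nat.cast_inj (R := ℤ), Nat.cast_mul, Nat.cast_add,
      hqp, Nat.cast_one, mul_zero, add_zero, sub_eq_zero, mul_right_inj' hq1.ne']
  have hzero : ∑ u ∈ X, f u = 0 → ∀ u, u ≠ 0 → Q u = 0 → f u = 0 := by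
    intro h u hu0 hu
    rw [h, mul_zero, sum_eq_zero_iff_of_nonneg fun _ _ => sq_nonneg _] at hsq
    exact pow_eq_zero_iff two_ne_zero |>.1 (hsq u (by simp [hu0, hu]))
  have hall : ∑ u ∈ X, f u = 0 →
      (∀ P ∈ M, (perpIn Q P M).ncard = (m - 1) * (Fintype.card F ^ (k + 1) + 1) + 1) ∧
      ∀ P : Submodule F V, IsSingularPoint Q P → P ∉ M →
        (perpIn Q P M).ncard = m * (Fintype.card F ^ (k + 1) + 1) := by
    intro h
    refine ⟨fun P hP => ?_, fun P hP hPM => ?_⟩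
    · obtain ⟨u, hu0, hu, rfl⟩ := hM P hP
      exact (hfin u ((hmemX u).2 ⟨hu0, hP⟩)).1 (hzero h u hu0 hu)
    · obtain ⟨u, hu0, hu, rfl⟩ := hP
      exact (hfout u fun hX => hPM ((hmemX u).1 hX).2).1 (hzero h u hu0 hu)
  tfae_have 1 → 3 := fun h =>
    hall (sum_eq_zero fun u hu => (hfin u hu).2 (h _ ((hmemX u).1 hu).2))
  tfae_have 2 → 3 := by
    refine fun h => hall (Eq.trans (sum_subset (fun u hu => ?_) fun u hu huX => ?_) hsum)
    · simpa using hX u hu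
    · have hu : u ≠ 0 ∧ Q u = 0 := by simpa using hu
      exact (hfout u huX).2 (h _ ⟨u, hu.1, hu.2, rfl⟩ fun hmem => huX ((hmemX u).2 ⟨hu.1, hmem⟩))
  tfae_have 3 → 1 := And.left
  tfae_have 3 → 2 := And.right
  tfae_finish
end
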